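/- arXiv:1506.03397 — 10 statements merged into one kernel-verified Lean document; each statement's English description precedes it below -/
import Mathlib

section
/- Let (e_n, e_n*) be a semi-normalized bounded biorthogonal system in an infinite-dimensional Banach space X. Then the system is 1-almost greedy if and only if it has Property (A). -/
open Finset

variable {𝕜 X : Type*}

section Defs

variable (𝕜) [RCLike 𝕜] [NormedAddCommGroup X] [NormedSpace 𝕜 X]

/-- A semi-normalized bounded biorthogonal system: biorthogonality, totality of the span,
and a uniform bound on the norms of the vectors and the functionals. -/
def BiorthSystem (e : ℕ → X) (f : ℕ → X →L[𝕜] 𝕜) : Prop :=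
  (∀ n k, f n (e k) = if n = k then (1 : 𝕜) else 0) ∧
  (Submodule.span 𝕜 (Set.range e)).topologicalClosure = ⊤ ∧
  ∃ M : ℝ, ∀ n, ‖e n‖ ≤ M ∧ ‖f n‖ ≤ M

variable {𝕜}

/-- The projection `P_A x = ∑_{n ∈ A} e_n*(x) e_n`. -/
noncomputable def greedyProj (e : ℕ → X) (f : ℕ → X →L[𝕜] 𝕜) (A : Finset ℕ) (x : X) : X :=
  ∑ n ∈ A, f n x • e n

/-- `A` is a greedy set for `x`: the coefficients on `A` dominate those outside `A`. -/
def IsGreedySet (f : ℕ → X →L[𝕜] 𝕜) (x : X) (A : Finset ℕ) : Prop :=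
  ∀ n ∈ A, ∀ k ∉ A, ‖f k x‖ ≤ ‖f n x‖

/-- The system is `C`-almost greedy. -/
def AlmostGreedyWith (e : ℕ → X) (f : ℕ → X →L[𝕜] 𝕜) (C : ℝ) : Prop :=
  ∀ (x : X) (A : Finset ℕ), IsGreedySet f x A →
    ∀ B : Finset ℕ, B.card ≤ A.card →
      ‖x - greedyProj e f A x‖ ≤ C * ‖x - greedyProj e f B x‖

/-- The system is `C`-suppression quasi-greedy. -/
def SuppressionQuasiGreedyWith (e : ℕ → X) (f : ℕ → X →L[𝕜] 𝕜) (C : ℝ) : Prop :=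
  ∀ (x : X) (A : Finset ℕ), IsGreedySet f x A →
    ‖x - greedyProj e f A x‖ ≤ C * ‖x‖

/-- The system is `K`-suppression unconditional. -/
def SuppressionUnconditionalWith (e : ℕ → X) (f : ℕ → X →L[𝕜] 𝕜) (K : ℝ) : Prop :=
  ∀ (x : X) (A : Finset ℕ), ‖x - greedyProj e f A x‖ ≤ K * ‖x‖

/-- The system is `C`-greedy. -/
def GreedyWith (e : ℕ → X) (f : ℕ → X →L[𝕜] 𝕜) (C : ℝ) : Prop :=
  ∀ (x : X) (A : Finset ℕ), IsGreedySet f x A →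
    ∀ (B : Finset ℕ), B.card = A.card → ∀ α : ℕ → 𝕜,
      ‖x - greedyProj e f A x‖ ≤ C * ‖x - ∑ n ∈ B, α n • e n‖

/-- The system is `C`-symmetric for largest coefficients; for `C = 1` this is Property (A). -/
def SymmetricLargestCoeffsWith (e : ℕ → X) (f : ℕ → X →L[𝕜] 𝕜) (C : ℝ) : Prop :=
  ∀ (z : X) (A B : Finset ℕ), Disjoint A B → A.card = B.card →
    (∀ n ∈ A ∪ B, f n z = 0) →
    ∀ (ε θ : ℕ → 𝕜), (∀ n ∈ A, ‖ε n‖ = 1) → (∀ n ∈ B, ‖θ n‖ = 1) →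
    ∀ t : 𝕜, (∀ n, ‖f n z‖ ≤ ‖t‖) →
      ‖z + t • ∑ n ∈ B, θ n • e n‖ ≤ C * ‖z + t • ∑ n ∈ A, ε n • e n‖

end Defs
section Helpers

variable {K E : Type*} [RCLike K] [NormedAddCommGroup E] [NormedSpace K E]

/-- Coefficients of a finite combination. -/
lemma coef_sum {e : ℕ → E} {f : ℕ → E →L[K] K}
    (h : ∀ n k, f n (e k) = if n = k then (1 : K) else 0) (A : Finset ℕ) (a : ℕ → K) (n : ℕ) :
    f n (∑ k ∈ A, a k • e k) = if n ∈ A then a n else 0 := by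
  simp [map_sum, h]

/-- Vectors of the span have finitely many nonzero coefficients. -/
lemma span_fin {e : ℕ → E} {f : ℕ → E →L[K] K}
    (h : ∀ n k, f n (e k) = if n = k then (1 : K) else 0) {y : E}
    (hy : y ∈ Submodule.span K (Set.range e)) : ∃ N, ∀ m, N ≤ m → f m y = 0 := by
  induction hy using Submodule.span_induction with
  | mem x hx =>
    obtain ⟨k, rfl⟩ := hx
    refine ⟨k + 1, fun m hm => ?_⟩
    rw [h, if_neg (by omega)]
  | zero => exact ⟨0, by simp⟩
  | add x y _ _ hx hy =>
    obtain ⟨N, hN⟩ := hx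
    obtain ⟨N', hN'⟩ := hy
    refine ⟨max N N', fun m hm => ?_⟩
    rw [map_add, hN m (le_trans (le_max_left _ _) hm), hN' m (le_trans (le_max_right _ _) hm),
      add_zero]
  | smul a x _ hx =>
    obtain ⟨N, hN⟩ := hx
    exact ⟨N, fun m hm => by rw [map_smul, hN m hm, smul_zero]⟩

/-- Single-vector exchange for finitely supported vectors. -/
lemma rot_fin {e : ℕ → E} {f : ℕ → E →L[K] K}
    (hA : SymmetricLargestCoeffsWith e f 1) {x : E} {k : ℕ} (hk : f k x = 0)
    (hx : ∃ N, ∀ m, N ≤ m → f m x = 0) {s u : K} (hs : ∀ n, ‖f n x‖ ≤ ‖s‖) (hu : ‖u‖ = 1) :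
    ‖x + (s * u) • e k‖ ≤ ‖x + s • e k‖ := by
  obtain ⟨N, hN⟩ := hx
  obtain ⟨m, hm, hmk⟩ : ∃ m, N ≤ m ∧ m ≠ k := ⟨N + k + 1, by omega, by omega⟩
  have h0 := hN m hm
  have h1 := hA x {m} {k} (by simpa using hmk) (by simp) (by simp [hk, h0])
    (fun _ => 1) (fun _ => u) (by simp) (by simp [hu]) s hs
  have h2 := hA x {k} {m} (by simpa using hmk.symm) (by simp) (by simp [hk, h0])
    (fun _ => 1) (fun _ => 1) (by simp) (by simp) s hs
  simp only [Finset.sum_singleton, one_smul, one_mul, smul_smul] at h1 h2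
  simpa [smul_smul] using h1.trans h2

/-- Rotation of one coefficient of maximal modulus. -/
lemma rot_gen {e : ℕ → E} {f : ℕ → E →L[K] K} (hsys : BiorthSystem K e f)
    (hA : SymmetricLargestCoeffsWith e f 1) {x : E} {k : ℕ} (hk : f k x = 0)
    {s u : K} (hs : ∀ n, ‖f n x‖ ≤ ‖s‖) (hu : ‖u‖ = 1) :
    ‖x + (s * u) • e k‖ ≤ ‖x + s • e k‖ := by
  obtain ⟨h, hd, M, hM⟩ := hsys
  by_cases s0 : s = 0
  · simp [s0]
  have hxm : x ∈ closure (Submodule.span K (Set.range e) : Set E) := by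
    rw [← Submodule.topologicalClosure_coe, hd]; trivial
  obtain ⟨y, hy, hyx⟩ := mem_closure_iff_seq_limit.1 hxm
  let z : ℕ → E := fun j => y j - f k (y j) • e k
  have hz : Filter.Tendsto z Filter.atTop (nhds x) := by
    have h1 : Filter.Tendsto (fun j => f k (y j)) Filter.atTop (nhds (f k x)) :=
      ((f k).continuous.tendsto x).comp hyx
    have := hyx.sub (h1.smul_const (e k))
    simpa [hk] using this
  have hzk : ∀ j, f k (z j) = 0 := fun j => by simp [z, h]
  have hzs : ∀ j, ∃ N, ∀ m, N ≤ m → f m (z j) = 0 := fun j =>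
    span_fin h (Submodule.sub_mem _ (hy j)
      (Submodule.smul_mem _ _ (Submodule.subset_span ⟨k, rfl⟩)))
  let r : ℕ → ℝ := fun j => 1 + M * ‖z j - x‖ / ‖s‖
  have hM0 : 0 ≤ M := (norm_nonneg _).trans (hM 0).1
  have hspos : 0 < ‖s‖ := norm_pos_iff.2 s0
  have hr0 : ∀ j, 0 ≤ r j := fun j => by
    have : 0 ≤ M * ‖z j - x‖ / ‖s‖ := by positivity
    simp only [r]; linarith
  have hr : Filter.Tendsto (fun j => ((r j : ℝ) : K)) Filter.atTop (nhds 1) := by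
    have h1 : Filter.Tendsto (fun j => ‖z j - x‖) Filter.atTop (nhds 0) :=
      tendsto_iff_norm_sub_tendsto_zero.1 hz
    have h2 : Filter.Tendsto r Filter.atTop (nhds 1) := by
      simpa using ((h1.const_mul M).div_const ‖s‖).const_add 1
    have := (RCLike.continuous_ofReal (K := K)).tendsto 1 |>.comp h2
    simpa [Function.comp_def] using this
  have hrs : Filter.Tendsto (fun j => s * ((r j : ℝ) : K)) Filter.atTop (nhds s) := by
    simpa using hr.const_mul s
  have key : ∀ j, ‖z j + (s * ((r j : ℝ) : K) * u) • e k‖ ≤ ‖z j + (s * ((r j : ℝ) : K)) • e k‖ := by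
    intro j
    refine rot_fin hA (hzk j) (hzs j) (fun n => ?_) hu
    have e1 : ‖s * ((r j : ℝ) : K)‖ = ‖s‖ + M * ‖z j - x‖ := by
      rw [norm_mul, RCLike.norm_ofReal, abs_of_nonneg (hr0 j)]
      simp only [r]; field_simp
    rw [e1]
    have e2 : f n (z j) = f n x + f n (z j - x) := by rw [← map_add]; congr 1; abel
    rw [e2]
    refine (norm_add_le _ _).trans (add_le_add (hs n) ?_)
    exact ((f n).le_opNorm _).trans (mul_le_mul_of_nonneg_right (hM n).2 (norm_nonneg _))
  refine le_of_tendsto_of_tendsto (b := Filter.atTop) ?_ ?_ (Filter.Eventually.of_forall key)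
  · exact (hz.add ((hrs.mul_const u).smul_const (e k))).norm
  · exact (hz.add (hrs.smul_const (e k))).norm

/-- Shrinking one coefficient of maximal modulus does not increase the norm. -/
lemma shrink_one {e : ℕ → E} {f : ℕ → E →L[K] K} (hsys : BiorthSystem K e f)
    (hA : SymmetricLargestCoeffsWith e f 1) {x : E} {k : ℕ} (hk : f k x = 0)
    {s r : K} (hs : ∀ n, ‖f n x‖ ≤ ‖s‖) (hr : ‖r‖ ≤ ‖s‖) :
    ‖x + r • e k‖ ≤ ‖x + s • e k‖ := by
  by_cases s0 : s = 0
  · have : r = 0 := by simpa [s0] using hr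
    simp [s0, this]
  have hspos : 0 < ‖s‖ := norm_pos_iff.2 s0
  have hconv : Convex ℝ {q : K | ‖x + q • e k‖ ≤ ‖x + s • e k‖} := by
    intro p hp q hq a b ha hb hab
    simp only [Set.mem_ofPred_eq] at hp hq ⊢
    have hab' : (a : K) + (b : K) = 1 := by rw [← RCLike.ofReal_add, hab, RCLike.ofReal_one]
    have e1 : x + (a • p + b • q) • e k
        = (a : K) • (x + p • e k) + (b : K) • (x + q • e k) := by
      have : x = ((a : K) + (b : K)) • x := by rw [hab', one_smul]
      rw [RCLike.real_smul_eq_coe_mul, RCLike.real_smul_eq_coe_mul]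
      nth_rewrite 1 [this]
      module
    rw [e1]
    refine (norm_add_le _ _).trans ?_
    rw [norm_smul, norm_smul, RCLike.norm_ofReal, RCLike.norm_ofReal, abs_of_nonneg ha,
      abs_of_nonneg hb]
    calc a * ‖x + p • e k‖ + b * ‖x + q • e k‖
        ≤ a * ‖x + s • e k‖ + b * ‖x + s • e k‖ := by gcongr
      _ = ‖x + s • e k‖ := by rw [← add_mul, hab, one_mul]
  have hsub : Metric.sphere (0 : K) ‖s‖ ⊆ {q : K | ‖x + q • e k‖ ≤ ‖x + s • e k‖} := by
    intro q hq
    have hq' : ‖q‖ = ‖s‖ := by simpa using hq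
    have := rot_gen hsys hA hk (s := s) (u := q / s) hs
      (by rw [norm_div, hq', div_self hspos.ne'])
    rwa [mul_div_cancel₀ _ s0] at this
  have := convexHull_min hsub hconv
  rw [convexHull_sphere_eq_closedBall (0 : K) (norm_nonneg s)] at this
  exact this (by simpa using hr)

/-- Shrinking several large coefficients below the level `t`. -/
lemma shrink_many {e : ℕ → E} {f : ℕ → E →L[K] K} (hsys : BiorthSystem K e f)
    (hA : SymmetricLargestCoeffsWith e f 1) (t : ℝ) (a b : ℕ → K) :
    ∀ (N : ℕ) (A : Finset ℕ) (y : E), A.card = N → (∀ n ∈ A, f n y = 0) →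
      (∀ n, ‖f n y‖ ≤ t) → (∀ n ∈ A, ‖b n‖ ≤ t) → (∀ n ∈ A, t ≤ ‖a n‖) →
      ‖y + ∑ n ∈ A, b n • e n‖ ≤ ‖y + ∑ n ∈ A, a n • e n‖ := by
  have h := hsys.1
  intro N
  induction N with
  | zero =>
    intro A y hc _ _ _ _
    rw [Finset.card_eq_zero.1 hc]
    simp
  | succ N ih =>
    intro A y hc hy0 hyt hb ha
    have hne : A.Nonempty := Finset.card_pos.1 (by omega)
    obtain ⟨k, hkA, hkmax⟩ := Finset.exists_max_image A (fun n => ‖a n‖) hne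
    have t0 : 0 ≤ t := (norm_nonneg _).trans (hyt 0)
    rw [← Finset.add_sum_erase A _ hkA, ← Finset.add_sum_erase A (fun n => a n • e n) hkA]
    have h1 := ih (A.erase k) (y + b k • e k) (by rw [Finset.card_erase_of_mem hkA]; omega)
      (fun n hn => by
        have := Finset.mem_erase.1 hn
        simp [h, hy0 n this.2, this.1])
      (fun n => by
        by_cases hn : n = k
        · subst hn
          simpa [h, hy0 n hkA] using hb n hkA
        · simpa [h, hn] using hyt n)
      (fun n hn => hb n (Finset.mem_of_mem_erase hn))
      (fun n hn => ha n (Finset.mem_of_mem_erase hn))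
    have h2 := shrink_one hsys hA (x := y + ∑ n ∈ A.erase k, a n • e n) (k := k) (s := a k)
      (r := b k) (by rw [map_add, coef_sum h]; simp [hy0 k hkA])
      (fun n => by
        rw [map_add, coef_sum h]
        split_ifs with hn
        · have hn' := Finset.mem_of_mem_erase hn
          rw [hy0 n hn', zero_add]
          exact hkmax n hn'
        · rw [add_zero]
          exact (hyt n).trans (ha k hkA))
      ((hb k hkA).trans (ha k hkA))
    calc ‖y + (b k • e k + ∑ n ∈ A.erase k, b n • e n)‖
        = ‖y + b k • e k + ∑ n ∈ A.erase k, b n • e n‖ := by rw [add_assoc]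
      _ ≤ ‖y + b k • e k + ∑ n ∈ A.erase k, a n • e n‖ := h1
      _ = ‖y + ∑ n ∈ A.erase k, a n • e n + b k • e k‖ := by congr 1; abel
      _ ≤ ‖y + ∑ n ∈ A.erase k, a n • e n + a k • e k‖ := h2
      _ = ‖y + (a k • e k + ∑ n ∈ A.erase k, a n • e n)‖ := by congr 1; abel

end Helpers

variable [RCLike 𝕜] [NormedAddCommGroup X] [NormedSpace 𝕜 X] [CompleteSpace X]

/-- A semi-normalized bounded biorthogonal system in an infinite-dimensional Banach space
is `1`-almost greedy if and only if it has Property (A). -/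
theorem stmt_0 (hX : ¬ FiniteDimensional 𝕜 X) (e : ℕ → X) (f : ℕ → X →L[𝕜] 𝕜)
    (hsys : BiorthSystem 𝕜 e f) :
    AlmostGreedyWith e f 1 ↔ SymmetricLargestCoeffsWith e f 1 := by
  classical
  have h := hsys.1
  constructor
  · intro hG z A B hAB hc hz ε θ hε hθ t ht
    have hzA : ∀ n ∈ A, f n z = 0 := fun n hn => hz n (Finset.mem_union_left _ hn)
    have hzB : ∀ n ∈ B, f n z = 0 := fun n hn => hz n (Finset.mem_union_right _ hn)
    set x := z + t • ∑ n ∈ A, ε n • e n + t • ∑ n ∈ B, θ n • e n with hx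
    have hcoef : ∀ n, f n x = f n z + t * (if n ∈ A then ε n else 0)
        + t * (if n ∈ B then θ n else 0) := by
      intro n
      rw [hx, map_add, map_add, map_smul, map_smul, coef_sum h, coef_sum h, smul_eq_mul,
        smul_eq_mul]
    have hcA : ∀ n ∈ A, f n x = t * ε n := fun n hn => by
      rw [hcoef, if_pos hn, if_neg (Finset.disjoint_left.1 hAB hn), hzA n hn]; simp
    have hcB : ∀ n ∈ B, f n x = t * θ n := fun n hn => by
      rw [hcoef, if_pos hn, if_neg (Finset.disjoint_right.1 hAB hn), hzB n hn]; simp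
    have hPA : greedyProj e f A x = t • ∑ n ∈ A, ε n • e n := by
      rw [greedyProj, Finset.smul_sum]
      exact Finset.sum_congr rfl fun n hn => by rw [hcA n hn, mul_smul]
    have hPB : greedyProj e f B x = t • ∑ n ∈ B, θ n • e n := by
      rw [greedyProj, Finset.smul_sum]
      exact Finset.sum_congr rfl fun n hn => by rw [hcB n hn, mul_smul]
    have hg : IsGreedySet f x A := by
      intro n hn k hk
      rw [hcA n hn, norm_mul, hε n hn, mul_one]
      by_cases hkB : k ∈ B
      · rw [hcB k hkB, norm_mul, hθ k hkB, mul_one]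
      · rw [hcoef, if_neg hk, if_neg hkB]
        simpa using ht k
    have := hG x A hg B hc.ge
    rw [hPA, hPB] at this
    convert this using 2
    · rw [hx]; abel_nf
    · rw [hx]; abel_nf
  · intro hA x A hg B hc
    rw [one_mul]
    set y := x - ∑ n ∈ A ∪ B, f n x • e n with hy
    have hsplitA : x - greedyProj e f A x = y + ∑ n ∈ B \ A, f n x • e n := by
      have : ∑ n ∈ A ∪ B, f n x • e n
          = ∑ n ∈ A, f n x • e n + ∑ n ∈ B \ A, f n x • e n := by
        rw [← Finset.sum_union Finset.disjoint_sdiff, Finset.union_sdiff_self_eq_union]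
      rw [hy, this, greedyProj]; abel
    have hsplitB : x - greedyProj e f B x = y + ∑ n ∈ A \ B, f n x • e n := by
      have : ∑ n ∈ A ∪ B, f n x • e n
          = ∑ n ∈ B, f n x • e n + ∑ n ∈ A \ B, f n x • e n := by
        rw [← Finset.sum_union Finset.disjoint_sdiff, Finset.union_sdiff_self_eq_union,
          Finset.union_comm]
      rw [hy, this, greedyProj]; abel
    rw [hsplitA, hsplitB]
    have hcy : ∀ n, f n y = if n ∈ A ∪ B then 0 else f n x := by
      intro n
      rw [hy, map_sub, coef_sum h]
      split_ifs <;> simp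
    have hcard : (B \ A).card ≤ (A \ B).card := by
      have h1 := Finset.card_sdiff_add_card_inter A B
      have h2 := Finset.card_sdiff_add_card_inter B A
      rw [Finset.inter_comm] at h2
      omega
    rcases (A \ B).eq_empty_or_nonempty with hem | hne
    · have : B \ A = ∅ := Finset.card_eq_zero.1 (by rw [hem, Finset.card_empty] at hcard; omega)
      rw [hem, this]
    obtain ⟨k, hk, hkmin⟩ := Finset.exists_min_image (A \ B) (fun n => ‖f n x‖) hne
    have hkA := (Finset.mem_sdiff.1 hk).1
    set t : ℝ := ‖f k x‖ with ht
    have ht0 : 0 ≤ t := norm_nonneg _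
    have htn : ‖(t : 𝕜)‖ = t := by rw [RCLike.norm_ofReal, abs_of_nonneg ht0]
    have hyt : ∀ n, ‖f n y‖ ≤ t := by
      intro n
      rw [hcy]
      split_ifs with hn
      · simpa using ht0
      · exact hg k hkA n fun hh => hn (Finset.mem_union_left _ hh)
    have hy0 : ∀ n ∈ A ∪ B, f n y = 0 := fun n hn => by rw [hcy, if_pos hn]
    obtain ⟨D, hDA, hDc⟩ := Finset.exists_subset_card_eq hcard
    have hD : ∀ n ∈ D, n ∈ A ∧ n ∉ B := fun n hn => Finset.mem_sdiff.1 (hDA hn)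
    have s1 := shrink_many hsys hA t (fun _ => (t : 𝕜)) (fun n => f n x) _ (B \ A) y rfl
      (fun n hn => hy0 n (Finset.mem_union_right _ (Finset.mem_sdiff.1 hn).1)) hyt
      (fun n hn => hg k hkA n (Finset.mem_sdiff.1 hn).2) (fun n _ => htn.ge)
    have s2 := hA y D (B \ A)
      (Finset.disjoint_left.2 fun n hn hn' => (hD n hn).2 (Finset.mem_sdiff.1 hn').1) hDc
      (fun n hn => by
        rcases Finset.mem_union.1 hn with hn | hn
        · exact hy0 n (Finset.mem_union_left _ (hD n hn).1)
        · exact hy0 n (Finset.mem_union_right _ (Finset.mem_sdiff.1 hn).1))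
      (fun _ => 1) (fun _ => 1) (by simp) (by simp) (t : 𝕜) (fun n => by rw [htn]; exact hyt n)
    have s3 := shrink_many hsys hA t (fun n => f n x) (fun n => if n ∈ D then (t : 𝕜) else 0) _
      (A \ B) y rfl
      (fun n hn => hy0 n (Finset.mem_union_left _ (Finset.mem_sdiff.1 hn).1)) hyt
      (fun n hn => by
        show ‖(if n ∈ D then (t : 𝕜) else 0)‖ ≤ t
        split_ifs
        · exact htn.le
        · simpa using ht0)
      (fun n hn => hkmin n hn)
    have hs : ∑ n ∈ A \ B, (if n ∈ D then (t : 𝕜) else 0) • e n = ∑ n ∈ D, (t : 𝕜) • e n := by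
      rw [← Finset.sum_subset hDA]
      · exact Finset.sum_congr rfl fun n hn => by rw [if_pos hn]
      · intro n _ hn
        rw [if_neg hn, zero_smul]
    simp only [one_smul, one_mul, Finset.smul_sum] at s2
    rw [hs] at s3
    exact s1.trans (s2.trans s3)
end

section
/- Let (e_n, e_n*) be a semi-normalized bounded biorthogonal system in an infinite-dimensional Banach space X and let C ≥ 1. If the system is C-almost greedy, then it is C-suppression quasi-greedy and C-symmetric for largest coefficients. -/
open Finset

variable {𝕜 X : Type*}

variable [RCLike 𝕜] [NormedAddCommGroup X] [NormedSpace 𝕜 X] [CompleteSpace X]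

/-- If the system is `C`-almost greedy then it is `C`-suppression quasi-greedy and
`C`-symmetric for largest coefficients. -/
theorem stmt_1 (hX : ¬ FiniteDimensional 𝕜 X) (e : ℕ → X) (f : ℕ → X →L[𝕜] 𝕜)
    (hsys : BiorthSystem 𝕜 e f) (C : ℝ) (hC : 1 ≤ C)
    (hag : AlmostGreedyWith e f C) :
    SuppressionQuasiGreedyWith e f C ∧ SymmetricLargestCoeffsWith e f C := by
  obtain ⟨hb, -, -⟩ := hsys
  refine ⟨fun x A hA => ?_, ?_⟩
  · simpa [greedyProj] using hag x A hA ∅ (by simp)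
  intro z A B hAB hcard hz ε θ hε hθ t ht
  have key : ∀ (S : Finset ℕ) (c : ℕ → 𝕜) (n : ℕ),
      f n (∑ k ∈ S, c k • e k) = if n ∈ S then c n else 0 := by
    intro S c n
    simp [map_sum, hb]
  set x : X := z + t • ∑ n ∈ A, ε n • e n + t • ∑ n ∈ B, θ n • e n with hx
  have hfx : ∀ n, f n x = f n z + t * (if n ∈ A then ε n else 0)
      + t * (if n ∈ B then θ n else 0) := by
    intro n
    rw [hx, map_add, map_add, map_smul, map_smul, key, key, smul_eq_mul, smul_eq_mul]
  have hfA : ∀ n ∈ A, f n x = t * ε n := by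
    intro n hn
    have h2 : n ∉ B := Finset.disjoint_left.mp hAB hn
    rw [hfx, hz n (Finset.mem_union_left _ hn)]
    simp [hn, h2]
  have hfB : ∀ n ∈ B, f n x = t * θ n := by
    intro n hn
    have h2 : n ∉ A := Finset.disjoint_right.mp hAB hn
    rw [hfx, hz n (Finset.mem_union_right _ hn)]
    simp [hn, h2]
  have hPA : greedyProj e f A x = t • ∑ n ∈ A, ε n • e n := by
    rw [greedyProj, Finset.smul_sum]
    exact Finset.sum_congr rfl fun n hn => by rw [hfA n hn, mul_smul]
  have hPB : greedyProj e f B x = t • ∑ n ∈ B, θ n • e n := by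
    rw [greedyProj, Finset.smul_sum]
    exact Finset.sum_congr rfl fun n hn => by rw [hfB n hn, mul_smul]
  have hg : IsGreedySet f x A := by
    intro n hn k hk
    rw [hfA n hn, norm_mul, hε n hn, mul_one]
    by_cases hkB : k ∈ B
    · rw [hfB k hkB, norm_mul, hθ k hkB, mul_one]
    · rw [hfx]
      simpa [hk, hkB] using ht k
  have h := hag x A hg B hcard.ge
  rw [hPA, hPB] at h
  have e1 : x - t • ∑ n ∈ A, ε n • e n = z + t • ∑ n ∈ B, θ n • e n := by
    rw [hx]; abel
  have e2 : x - t • ∑ n ∈ B, θ n • e n = z + t • ∑ n ∈ A, ε n • e n := by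
    rw [hx]; abel
  rwa [e1, e2] at h
end

section
/- Let (e_n, e_n*) be a semi-normalized bounded biorthogonal system in an infinite-dimensional Banach space X and let K, C ≥ 1. If the system is K-suppression quasi-greedy and C-symmetric for largest coefficients, then it is C·K-almost greedy. -/
open Finset

variable {𝕜 X : Type*}

theorem aux_trunc {𝕜 X : Type*} [RCLike 𝕜] [NormedAddCommGroup X] [NormedSpace 𝕜 X]
    (e : ℕ → X) (f : ℕ → X →L[𝕜] 𝕜) (K : ℝ) (hqg : SuppressionQuasiGreedyWith e f K)
    (hK : 1 ≤ K) (y : X) :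
    ∀ (N : ℕ) (D : Finset ℕ), D.card = N → ∀ (M : ℝ) (μ : ℕ → ℝ), 0 ≤ M →
      (∀ n ∈ D, 0 ≤ μ n ∧ μ n ≤ M) →
      (∀ n ∈ D, ∀ k, (k ∉ D ∨ μ k < μ n) → ‖f k y‖ ≤ ‖f n y‖) →
      ‖(M : 𝕜) • y - ∑ n ∈ D, ((μ n : 𝕜) * f n y) • e n‖ ≤ M * (K * ‖y‖) := by
  intro N
  induction N using Nat.strong_induction_on with
  | _ N ih =>
  intro D hD M μ hM hμ hg
  rcases D.eq_empty_or_nonempty with rfl | hne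
  · simp only [Finset.sum_empty, sub_zero, norm_smul, RCLike.norm_ofReal, abs_of_nonneg hM]
    have : ‖y‖ ≤ K * ‖y‖ := by nlinarith [norm_nonneg y]
    exact mul_le_mul_of_nonneg_left this hM
  obtain ⟨j, hj, hmin⟩ := D.exists_min_image μ hne
  set D' := D.filter (fun n => μ j < μ n) with hD'
  have hlt : D'.card < N := by
    rw [← hD]
    apply Finset.card_lt_card
    refine ⟨Finset.filter_subset _ _, fun h => ?_⟩
    have := h hj
    simp [hD'] at this
  have h1 := ih _ hlt D' rfl (M - μ j) (fun n => μ n - μ j) (by linarith [(hμ j hj).2])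
    (by
      intro n hn
      rw [hD', Finset.mem_filter] at hn
      exact ⟨by linarith [hn.2], by linarith [(hμ n hn.1).2]⟩)
    (by
      intro n hn k hk
      rw [hD', Finset.mem_filter] at hn
      apply hg n hn.1 k
      rcases hk with hk | hk
      · by_cases hkD : k ∈ D
        · right
          rw [hD', Finset.mem_filter] at hk
          have : ¬ μ j < μ k := fun h => hk ⟨hkD, h⟩
          linarith [hn.2]
        · exact Or.inl hkD
      · right; simpa using hk)
  have h2 := hqg y D (fun n hn k hk => hg n hn k (Or.inl hk))
  have h3 : ∑ n ∈ D', (((μ n - μ j : ℝ) : 𝕜) * f n y) • e n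
      = ∑ n ∈ D, (((μ n - μ j : ℝ) : 𝕜) * f n y) • e n := by
    apply Finset.sum_subset (Finset.filter_subset _ _)
    intro n hn hn'
    rw [Finset.mem_filter] at hn'
    have : μ n - μ j = 0 := by
      have h4 : ¬ μ j < μ n := fun h => hn' ⟨hn, h⟩
      linarith [hmin n hn]
    simp [this]
  have h4 : (M : 𝕜) • y - ∑ n ∈ D, ((μ n : 𝕜) * f n y) • e n
      = ((μ j : ℝ) : 𝕜) • (y - greedyProj e f D y)
        + (((M - μ j : ℝ) : 𝕜) • y
            - ∑ n ∈ D', (((μ n - μ j : ℝ) : 𝕜) * f n y) • e n) := by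
    rw [h3, greedyProj]
    have : ∑ n ∈ D, (((μ n - μ j : ℝ) : 𝕜) * f n y) • e n
        = ∑ n ∈ D, ((μ n : 𝕜) * f n y) • e n - ((μ j : ℝ) : 𝕜) • ∑ n ∈ D, f n y • e n := by
      rw [Finset.smul_sum, ← Finset.sum_sub_distrib]
      refine Finset.sum_congr rfl fun n _ => ?_
      push_cast
      module
    rw [this]
    push_cast
    module
  rw [h4]
  refine (norm_add_le _ _).trans ?_
  rw [norm_smul, RCLike.norm_ofReal, abs_of_nonneg (hμ j hj).1]
  have := mul_le_mul_of_nonneg_left h2 (hμ j hj).1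
  linarith

theorem aux_convex {𝕜 X : Type*} [RCLike 𝕜] [NormedAddCommGroup X] [NormedSpace 𝕜 X]
    (e : ℕ → X) (t R : ℝ) (b : ℕ → 𝕜) (E : Finset ℕ) :
    (∀ n ∈ E, ‖b n‖ ≤ t) → ∀ z : X,
    (∀ θ : ℕ → 𝕜, (∀ n ∈ E, ‖θ n‖ = 1) → ‖z + (t : 𝕜) • ∑ n ∈ E, θ n • e n‖ ≤ R) →
    ‖z + ∑ n ∈ E, b n • e n‖ ≤ R := by
  induction E using Finset.induction_on with
  | empty =>
    intro _ z h
    simpa using h (fun _ => 1) (by simp)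
  | insert j E hj ih =>
    intro hb z h
    have hbE : ∀ n ∈ E, ‖b n‖ ≤ t := fun n hn => hb n (Finset.mem_insert_of_mem hn)
    have hbj : ‖b j‖ ≤ t := hb j (Finset.mem_insert_self _ _)
    have key : ∀ v : 𝕜, ‖v‖ = 1 → ‖(z + ((t : 𝕜) * v) • e j) + ∑ n ∈ E, b n • e n‖ ≤ R := by
      intro v hv
      apply ih hbE
      intro θ hθ
      have := h (Function.update θ j v) (by
        intro n hn
        by_cases hnj : n = j
        · subst hnj; simpa using hv
        · rw [Function.update_of_ne hnj]
          exact hθ n ((Finset.mem_insert.1 hn).resolve_left hnj))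
      rw [Finset.sum_insert hj, Function.update_self] at this
      have h5 : ∑ n ∈ E, (Function.update θ j v) n • e n = ∑ n ∈ E, θ n • e n := by
        refine Finset.sum_congr rfl fun n hn => ?_
        rw [Function.update_of_ne]
        rintro rfl; exact hj hn
      rw [h5] at this
      convert this using 2
      module
    have ht : 0 ≤ t := (norm_nonneg _).trans hbj
    obtain ⟨u, hu, hbu⟩ : ∃ u : 𝕜, ‖u‖ = 1 ∧ b j = (‖b j‖ : 𝕜) * u := by
      by_cases h0 : b j = 0
      · exact ⟨1, by simp, by simp [h0]⟩
      · have h0' : (‖b j‖ : 𝕜) ≠ 0 := by simpa using h0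
        exact ⟨b j / (‖b j‖ : 𝕜), by simp [h0], by field_simp⟩
    set r := ‖b j‖ / t with hr
    have hr0 : 0 ≤ r := by positivity
    have hr1 : r ≤ 1 := div_le_one_of_le₀ hbj ht
    have hrt : ‖b j‖ = r * t := by
      rcases ht.eq_or_lt with h0 | h0
      · have := norm_nonneg (b j)
        rw [← h0] at hbj ⊢
        linarith
      · rw [hr]; field_simp
    rw [Finset.sum_insert hj]
    have h6 : z + (b j • e j + ∑ n ∈ E, b n • e n)
        = (((1 + r) / 2 : ℝ) : 𝕜) • ((z + ((t : 𝕜) * u) • e j) + ∑ n ∈ E, b n • e n)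
        + (((1 - r) / 2 : ℝ) : 𝕜) • ((z + ((t : 𝕜) * (-u)) • e j) + ∑ n ∈ E, b n • e n) := by
      rw [hbu, hrt]
      push_cast
      module
    rw [h6]
    refine (norm_add_le _ _).trans ?_
    rw [norm_smul, norm_smul, RCLike.norm_ofReal, RCLike.norm_ofReal,
      abs_of_nonneg (by linarith), abs_of_nonneg (by linarith)]
    have k1 := mul_le_mul_of_nonneg_left (key u hu) (show 0 ≤ (1 + r) / 2 by linarith)
    have k2 := mul_le_mul_of_nonneg_left (key (-u) (by simpa using hu))
      (show 0 ≤ (1 - r) / 2 by linarith)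
    linarith

theorem aux_choose (a : ℕ → ℝ) (D : Finset ℕ) : ∀ k ≤ D.card, ∃ D' ⊆ D, D'.card = k ∧
    ∀ n ∈ D', ∀ m ∈ D \ D', a n ≤ a m := by
  intro k
  induction k with
  | zero => intro _; exact ⟨∅, by simp, by simp, by simp⟩
  | succ k ih =>
    intro hk
    obtain ⟨D', hs, hc, h⟩ := ih (by omega)
    have hne : (D \ D').Nonempty := by
      rw [← Finset.card_pos, Finset.card_sdiff_of_subset hs]; omega
    obtain ⟨j, hj, hmin⟩ := (D \ D').exists_min_image a hne
    have hj' := Finset.mem_sdiff.1 hj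
    refine ⟨insert j D', Finset.insert_subset hj'.1 hs, by
      rw [Finset.card_insert_of_notMem hj'.2, hc], ?_⟩
    intro n hn m hm
    have hm' : m ∈ D \ D' := by
      simp only [Finset.mem_sdiff, Finset.mem_insert, not_or] at hm ⊢
      exact ⟨hm.1, hm.2.2⟩
    rcases Finset.mem_insert.1 hn with rfl | hn
    · exact hmin m hm'
    · exact h n hn m hm'

theorem aux_coef {𝕜 X : Type*} [RCLike 𝕜] [NormedAddCommGroup X] [NormedSpace 𝕜 X]
    (e : ℕ → X) (f : ℕ → X →L[𝕜] 𝕜)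
    (hb : ∀ n k, f n (e k) = if n = k then (1 : 𝕜) else 0) (B : Finset ℕ) (x : X) (n : ℕ) :
    f n (x - greedyProj e f B x) = if n ∈ B then 0 else f n x := by
  rw [greedyProj, map_sub, map_sum]
  simp only [map_smul, hb, smul_eq_mul, mul_ite, mul_one, mul_zero, Finset.sum_ite_eq]
  split_ifs <;> simp

variable [RCLike 𝕜] [NormedAddCommGroup X] [NormedSpace 𝕜 X] [CompleteSpace X]

/-- If the system is `K`-suppression quasi-greedy and `C`-symmetric for largest coefficients
then it is `C*K`-almost greedy. -/
theorem stmt_2 (hX : ¬ FiniteDimensional 𝕜 X) (e : ℕ → X) (f : ℕ → X →L[𝕜] 𝕜)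
    (hsys : BiorthSystem 𝕜 e f) (K C : ℝ) (hK : 1 ≤ K) (hC : 1 ≤ C)
    (hqg : SuppressionQuasiGreedyWith e f K)
    (hslc : SymmetricLargestCoeffsWith e f C) :
    AlmostGreedyWith e f (C * K) := by
  intro x A hA B hBA
  have hb := hsys.1
  rcases A.eq_empty_or_nonempty with rfl | hne
  · have : B = ∅ := by simpa using hBA
    subst this
    have : 1 ≤ C * K := by nlinarith
    nlinarith [norm_nonneg (x - greedyProj e f ∅ x)]
  obtain ⟨j, hj, hmin⟩ := A.exists_min_image (fun n => ‖f n x‖) hne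
  set t := ‖f j x‖ with ht
  have ht0 : 0 ≤ t := norm_nonneg _
  have hout : ∀ k, k ∉ A → ‖f k x‖ ≤ t := fun k hk => hA j hj k hk
  set y := x - greedyProj e f B x with hy
  have hyc : ∀ n, f n y = if n ∈ B then 0 else f n x := aux_coef e f hb B x
  set z := x - greedyProj e f (A ∪ B) x with hz
  have hzc : ∀ n, f n z = if n ∈ A ∪ B then 0 else f n x := aux_coef e f hb (A ∪ B) x
  have hcard : (B \ A).card ≤ (A \ B).card := by
    have h1 := Finset.card_sdiff_add_card_inter A B
    have h2 := Finset.card_sdiff_add_card_inter B A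
    rw [Finset.inter_comm] at h2
    omega
  obtain ⟨D', hD's, hD'c, hD'⟩ := aux_choose (fun n => ‖f n x‖) (A \ B) _ hcard
  have hyD : ∀ n ∈ A \ B, f n y = f n x := by
    intro n hn
    rw [hyc, if_neg (Finset.mem_sdiff.1 hn).2]
  -- signs
  have hsign : ∀ n, ∃ u : 𝕜, ‖u‖ = 1 ∧ f n x = (‖f n x‖ : 𝕜) * u := by
    intro n
    by_cases h0 : f n x = 0
    · exact ⟨1, by simp, by simp [h0]⟩
    · have h0' : (‖f n x‖ : 𝕜) ≠ 0 := by simpa using h0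
      exact ⟨f n x / (‖f n x‖ : 𝕜), by simp [h0], by field_simp⟩
  choose ε hε1 hε using hsign
  classical
  set μ : ℕ → ℝ := fun n => if n ∈ D' then 1 - t / ‖f n x‖ else 1 with hμ
  have htr := aux_trunc e f K hqg hK y _ (A \ B) rfl 1 μ zero_le_one
    (by
      intro n hn
      simp only [hμ]
      split_ifs
      · have h1 : t / ‖f n x‖ ≤ 1 :=
          div_le_one_of_le₀ (hmin n (Finset.mem_sdiff.1 hn).1) (norm_nonneg _)
        have h2 : 0 ≤ t / ‖f n x‖ := by positivity
        constructor <;> linarith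
      · simp)
    (by
      intro n hn k hk
      have hnA := (Finset.mem_sdiff.1 hn).1
      rw [hyD n hn]
      by_cases hkD : k ∈ A \ B
      · rw [hyD k hkD]
        have hlt := hk.resolve_left (fun h => h hkD)
        simp only [hμ] at hlt
        by_cases hkD' : k ∈ D'
        · by_cases hnD' : n ∈ D'
          · rw [if_pos hkD', if_pos hnD'] at hlt
            by_contra hcon
            push Not at hcon
            have hlt' : t / ‖f n x‖ < t / ‖f k x‖ := by linarith
            rcases (norm_nonneg (f n x)).eq_or_lt with h0 | h0
            · have : t = 0 := le_antisymm (by rw [h0]; exact hmin n hnA) ht0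
              simp [this] at hlt'
            · have := div_le_div_of_nonneg_left ht0 h0 hcon.le
              linarith
          · exact hD' k hkD' n (Finset.mem_sdiff.2 ⟨hn, hnD'⟩)
        · rw [if_neg hkD'] at hlt
          exfalso
          split_ifs at hlt
          · have h2 : 0 ≤ t / ‖f n x‖ := by positivity
            linarith
          · linarith
      · rw [hyc]
        split_ifs with hkB
        · simp
        · have hkA : k ∉ A := fun h => hkD (Finset.mem_sdiff.2 ⟨h, hkB⟩)
          exact hA n hnA k hkA)
  have hPu : greedyProj e f (A ∪ B) x = greedyProj e f B x + greedyProj e f (A \ B) x := by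
    unfold greedyProj
    rw [← Finset.sdiff_union_self_eq_union, Finset.sum_union Finset.sdiff_disjoint, add_comm]
  have hPu' : greedyProj e f (A ∪ B) x = greedyProj e f A x + greedyProj e f (B \ A) x := by
    unfold greedyProj
    rw [Finset.union_comm, ← Finset.sdiff_union_self_eq_union,
      Finset.sum_union Finset.sdiff_disjoint, add_comm]
  have heq : ((1 : ℝ) : 𝕜) • y - ∑ n ∈ A \ B, ((μ n : 𝕜) * f n y) • e n
      = z + (t : 𝕜) • ∑ n ∈ D', ε n • e n := by
    have h1 : (t : 𝕜) • ∑ n ∈ D', ε n • e n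
        = ∑ n ∈ A \ B, (f n x - (μ n : 𝕜) * f n y) • e n := by
      rw [Finset.smul_sum, ← Finset.sum_subset hD's]
      · refine Finset.sum_congr rfl fun n hn => ?_
        rw [hyD n (hD's hn), smul_smul]
        congr 1
        simp only [hμ, if_pos hn]
        have hle := hmin n (Finset.mem_sdiff.1 (hD's hn)).1
        have h3 : t = t / ‖f n x‖ * ‖f n x‖ := by
          rcases (norm_nonneg (f n x)).eq_or_lt with h0 | h0
          · have : t = 0 := le_antisymm (by rw [h0]; exact hle) ht0
            simp [this]
          · field_simp
        have h4 : (t : 𝕜) = ((t / ‖f n x‖ : ℝ) : 𝕜) * (‖f n x‖ : 𝕜) := by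
          rw [← RCLike.ofReal_mul, ← h3]
        rw [h4, mul_assoc, ← hε n, RCLike.ofReal_sub, RCLike.ofReal_one]
        ring
      · intro n hn hn'
        rw [hyD n hn]
        simp [hμ, hn']
    rw [h1, hz, hPu, hy]
    simp only [sub_smul, Finset.sum_sub_distrib, RCLike.ofReal_one, one_smul]
    unfold greedyProj
    abel
  rw [heq, one_mul] at htr
  have hfin : x - greedyProj e f A x = z + ∑ n ∈ B \ A, f n x • e n := by
    rw [hz, hPu']
    unfold greedyProj
    abel
  rw [hfin]
  apply aux_convex e t (C * K * ‖y‖) (fun n => f n x) (B \ A)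
    (fun n hn => hout n (Finset.mem_sdiff.1 hn).2)
  intro θ hθ
  have hs := hslc z D' (B \ A)
    (by
      rw [Finset.disjoint_left]
      intro n hn hn'
      exact (Finset.mem_sdiff.1 hn').2 (Finset.mem_sdiff.1 (hD's hn)).1)
    hD'c
    (by
      intro n hn
      rw [hzc, if_pos]
      rcases Finset.mem_union.1 hn with h | h
      · exact Finset.mem_union_left _ (Finset.mem_sdiff.1 (hD's h)).1
      · exact Finset.mem_union_right _ (Finset.mem_sdiff.1 h).1)
    ε θ (fun n _ => hε1 n) hθ (t : 𝕜)
    (by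
      intro n
      rw [RCLike.norm_ofReal, abs_of_nonneg ht0, hzc]
      split_ifs with h
      · simpa using ht0
      · exact hout n (fun h' => h (Finset.mem_union_left _ h')))
  refine hs.trans ?_
  rw [mul_assoc]
  exact mul_le_mul_of_nonneg_left htr (by linarith)
end

section
/- Let (e_n, e_n*) be a semi-normalized bounded biorthogonal system in an infinite-dimensional Banach space X and let C ≥ 1. Suppose that for every x ∈ X, every strictly greedy set A for x (i.e., every finite set A ⊆ ℕ such that |e_k*(x)| < |e_n*(x)| for all n ∈ A and k ∉ A), and every finite set B ⊆ ℕ with |B| = |A|, one has ‖x − P_A(x)‖ ≤ C‖x − P_B(x)‖. Then for every x ∈ X, every greedy set A for x, and every finite set B ⊆ ℕ with |B| ≤ |A|, one has ‖x − P_A(x)‖ ≤ C‖x − P_B(x)‖. -/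
open Finset

variable {𝕜 X : Type*}

theorem aux_sign {𝕜 : Type*} [RCLike 𝕜] (a : 𝕜) : ∃ s : 𝕜, ‖s‖ = 1 ∧ a = (‖a‖ : 𝕜) * s := by
  by_cases ha : a = 0
  · exact ⟨1, by simp, by simp [ha]⟩
  · have hn : (‖a‖ : 𝕜) ≠ 0 := by simpa using ha
    refine ⟨a / (‖a‖ : 𝕜), ?_, ?_⟩
    · rw [norm_div, RCLike.norm_ofReal, abs_norm, div_self (by simpa using ha)]
    · field_simp

theorem aux_small {𝕜 X : Type*} [RCLike 𝕜] [NormedAddCommGroup X] [NormedSpace 𝕜 X]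
    (e : ℕ → X) (f : ℕ → X →L[𝕜] 𝕜) (hsys : BiorthSystem 𝕜 e f) (x : X) (ε : ℝ) (hε : 0 < ε) :
    ∃ N, ∀ n ≥ N, ‖f n x‖ ≤ ε := by
  obtain ⟨hb, hd, M, hM⟩ := hsys
  have hM0 : 0 ≤ M := (norm_nonneg _).trans (hM 0).1
  have hx : x ∈ closure (Submodule.span 𝕜 (Set.range e) : Set X) := by
    rw [← Submodule.topologicalClosure_coe, hd]; trivial
  obtain ⟨z, hz, hxz⟩ := Metric.mem_closure_iff.1 hx (ε / (M + 1)) (by positivity)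
  have hzN : ∃ N, ∀ n ≥ N, f n z = 0 := by
    refine Submodule.span_induction (p := fun z _ => ∃ N, ∀ n ≥ N, f n z = 0) ?_ ?_ ?_ ?_ hz
    · rintro _ ⟨k, rfl⟩
      refine ⟨k + 1, fun n hn => ?_⟩
      rw [hb, if_neg (by omega)]
    · exact ⟨0, fun n _ => by simp⟩
    · rintro a b _ _ ⟨N, hN⟩ ⟨K, hK⟩
      exact ⟨max N K, fun n hn => by
        rw [map_add, hN n (le_trans (le_max_left _ _) hn),
          hK n (le_trans (le_max_right _ _) hn), add_zero]⟩
    · rintro c a _ ⟨N, hN⟩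
      exact ⟨N, fun n hn => by rw [map_smul, hN n hn, smul_zero]⟩
  obtain ⟨N, hN⟩ := hzN
  refine ⟨N, fun n hn => ?_⟩
  have h1 : f n x = f n (x - z) := by rw [map_sub, hN n hn, sub_zero]
  rw [h1]
  rw [dist_eq_norm] at hxz
  calc ‖f n (x - z)‖ ≤ ‖f n‖ * ‖x - z‖ := (f n).le_opNorm _
    _ ≤ (M + 1) * (ε / (M + 1)) := by
        gcongr
        linarith [(hM n).2]
    _ = ε := by field_simp

theorem aux_eq {𝕜 X : Type*} [RCLike 𝕜] [NormedAddCommGroup X] [NormedSpace 𝕜 X]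
    (e : ℕ → X) (f : ℕ → X →L[𝕜] 𝕜) (hsys : BiorthSystem 𝕜 e f) (C : ℝ)
    (h : ∀ (x : X) (A : Finset ℕ), (∀ n ∈ A, ∀ k ∉ A, ‖f k x‖ < ‖f n x‖) →
      ∀ B : Finset ℕ, B.card = A.card →
        ‖x - greedyProj e f A x‖ ≤ C * ‖x - greedyProj e f B x‖)
    (x : X) (A : Finset ℕ) (hA : IsGreedySet f x A) (B : Finset ℕ) (hB : B.card = A.card) :
    ‖x - greedyProj e f A x‖ ≤ C * ‖x - greedyProj e f B x‖ := by
  choose s hs1 hs2 using fun n => aux_sign (f n x)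
  set v : X := ∑ n ∈ A, s n • e n with hv
  have hfv : ∀ n, f n v = if n ∈ A then s n else 0 := by
    intro n
    simp [hv, map_sum, hsys.1]
  have hcont : Continuous fun δ : ℝ =>
      C * ‖(x + (δ : 𝕜) • v) - greedyProj e f B (x + (δ : 𝕜) • v)‖ := by
    unfold greedyProj
    have := RCLike.continuous_ofReal (K := 𝕜)
    fun_prop
  have ht := (hcont.tendsto 0).mono_left (nhdsWithin_le_nhds (s := Set.Ioi 0))
  simp only [RCLike.ofReal_zero, zero_smul, add_zero] at ht
  refine ge_of_tendsto ht ?_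
  filter_upwards [self_mem_nhdsWithin] with δ hδ
  have hδ : 0 < δ := hδ
  have key := h (x + (δ : 𝕜) • v) A ?_ B hB
  · have : greedyProj e f A (x + (δ : 𝕜) • v) = greedyProj e f A x + (δ : 𝕜) • v := by
      have hdv : (δ : 𝕜) • v = ∑ n ∈ A, (δ : 𝕜) • s n • e n := by rw [hv, Finset.smul_sum]
      unfold greedyProj
      conv_rhs => rw [hdv, ← Finset.sum_add_distrib]
      refine Finset.sum_congr rfl fun n hn => ?_
      rw [map_add, map_smul, hfv, if_pos hn, add_smul, smul_eq_mul, mul_smul]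
    have h0 : x + (δ : 𝕜) • v - greedyProj e f A (x + (δ : 𝕜) • v) = x - greedyProj e f A x := by
      rw [this]; abel
    rwa [h0] at key
  · intro n hn k hk
    have h1 : f k (x + (δ : 𝕜) • v) = f k x := by simp [hfv, hk]
    have h2 : f n (x + (δ : 𝕜) • v) = ((‖f n x‖ + δ : ℝ) : 𝕜) * s n := by
      rw [map_add, map_smul, hfv, if_pos hn, smul_eq_mul, RCLike.ofReal_add, add_mul, ← hs2]
    rw [h1, h2, norm_mul, hs1, mul_one, RCLike.norm_ofReal, abs_of_nonneg (by positivity)]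
    linarith [hA n hn k hk]

variable [RCLike 𝕜] [NormedAddCommGroup X] [NormedSpace 𝕜 X] [CompleteSpace X]

/-- If the almost greedy inequality holds for strictly greedy sets `A` and sets `B` with
`|B| = |A|`, then it holds for all greedy sets `A` and all sets `B` with `|B| ≤ |A|`. -/
theorem stmt_3 (hX : ¬ FiniteDimensional 𝕜 X) (e : ℕ → X) (f : ℕ → X →L[𝕜] 𝕜)
    (hsys : BiorthSystem 𝕜 e f) (C : ℝ) (hC : 1 ≤ C)
    (h : ∀ (x : X) (A : Finset ℕ), (∀ n ∈ A, ∀ k ∉ A, ‖f k x‖ < ‖f n x‖) →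
      ∀ B : Finset ℕ, B.card = A.card →
        ‖x - greedyProj e f A x‖ ≤ C * ‖x - greedyProj e f B x‖) :
    ∀ (x : X) (A : Finset ℕ), IsGreedySet f x A →
      ∀ B : Finset ℕ, B.card ≤ A.card →
        ‖x - greedyProj e f A x‖ ≤ C * ‖x - greedyProj e f B x‖ := by
  intro x A hA B hB
  have hsys' := hsys
  obtain ⟨-, -, M, hM⟩ := hsys'
  have hM0 : 0 ≤ M := (norm_nonneg _).trans (hM 0).1
  refine le_of_forall_pos_le_add fun ε hε => ?_
  set m := A.card - B.card with hm
  have hK : 0 < C * (m * (M + 1)) + 1 := by positivity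
  obtain ⟨N, hN⟩ := aux_small e f hsys x (ε / (C * (m * (M + 1)) + 1)) (by positivity)
  set N' := max N (B.sup id + 1)
  set D := Finset.Ico N' (N' + m) with hD
  have hdisj : Disjoint B D := by
    rw [Finset.disjoint_left]
    intro n hn hn'
    have h1 : n ≤ B.sup id := Finset.le_sup (f := id) hn
    have h2 := (Finset.mem_Ico.1 hn').1
    have h3 : B.sup id + 1 ≤ N' := le_max_right _ _
    omega
  have hDc : D.card = m := by simp [hD]
  have hcard : (B ∪ D).card = A.card := by
    rw [Finset.card_union_of_disjoint hdisj, hDc]; omega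
  have key := aux_eq e f hsys C h x A hA (B ∪ D) hcard
  have hP : greedyProj e f (B ∪ D) x = greedyProj e f B x + greedyProj e f D x :=
    Finset.sum_union hdisj
  have hPD : ‖greedyProj e f D x‖ ≤ m * ((ε / (C * (m * (M + 1)) + 1)) * (M + 1)) := by
    unfold greedyProj
    refine (norm_sum_le_of_le D (n := fun n => (ε / (C * (m * (M + 1)) + 1)) * (M + 1))
      fun n hn => ?_).trans ?_
    · rw [norm_smul]
      have := hN n ((le_max_left _ _).trans (Finset.mem_Ico.1 hn).1)
      have := (hM n).1
      gcongr
      linarith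
    · rw [Finset.sum_const, hDc, nsmul_eq_mul]
  have h4 : ‖x - greedyProj e f (B ∪ D) x‖ ≤
      ‖x - greedyProj e f B x‖ + ‖greedyProj e f D x‖ := by
    rw [hP, ← sub_sub]; exact norm_sub_le _ _
  have h5 : C * (m * ((ε / (C * (m * (M + 1)) + 1)) * (M + 1))) ≤ ε := by
    have : C * (m * ((ε / (C * (m * (M + 1)) + 1)) * (M + 1)))
      = ε * (C * (m * (M + 1))) / (C * (m * (M + 1)) + 1) := by ring
    rw [this, div_le_iff₀ hK]
    nlinarith
  have hC0 : 0 ≤ C := by linarith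
  have h6 := mul_le_mul_of_nonneg_left h4 hC0
  have h7 := mul_le_mul_of_nonneg_left hPD hC0
  rw [mul_add] at h6
  linarith
end

section
/- Let (e_n, e_n*) be a semi-normalized bounded biorthogonal system in an infinite-dimensional Banach space X which is C-suppression quasi-greedy for some C ≥ 1. Then for every N ∈ ℕ, every injective map ρ : {1,…,N} → ℕ, all scalars a_1,…,a_N with |a_1| ≥ |a_2| ≥ … ≥ |a_N|, and all real numbers 0 ≤ λ_1 ≤ λ_2 ≤ … ≤ λ_N ≤ 1, one has ‖∑_{i=1}^N λ_i a_i e_{ρ(i)}‖ ≤ C ‖∑_{i=1}^N a_i e_{ρ(i)}‖. -/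
open Finset

variable {𝕜 X : Type*}

/-- Abel summation: a non-decreasing multiplier is controlled by the tails. -/
theorem abel_tails {𝕜 X : Type*} [RCLike 𝕜] [NormedAddCommGroup X] [NormedSpace 𝕜 X]
    (K : ℝ) (hK : 0 ≤ K) (N : ℕ) :
    ∀ (v : Fin N → X) (l : Fin N → ℝ) (M : ℝ), 0 ≤ M → (∀ i, 0 ≤ l i) → (∀ i, l i ≤ M) →
      (∀ i j : Fin N, i ≤ j → l i ≤ l j) →
      (∀ m : Fin N, ‖∑ i, (if m ≤ i then v i else 0)‖ ≤ K) →
      ‖∑ i, (l i : 𝕜) • v i‖ ≤ M * K := by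
  induction N with
  | zero =>
    intro v l M hM _ _ _ _
    simpa using mul_nonneg hM hK
  | succ n ih =>
    intro v l M hM h0 h1 hm ht
    have h := ih (fun i => v i.succ) (fun i => l i.succ - l 0) (M - l 0)
      (by linarith [h1 0]) (fun i => by linarith [hm 0 i.succ (Fin.zero_le _)])
      (fun i => by linarith [h1 i.succ])
      (fun i j hij => by linarith [hm i.succ j.succ (Fin.succ_le_succ_iff.2 hij)])
      (fun m => by
        have := ht m.succ
        rw [Fin.sum_univ_succ] at this
        simpa [Fin.succ_le_succ_iff] using this)
    have h2 := ht 0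
    simp only [Fin.zero_le, if_true] at h2
    have heq : ∑ i, (l i : 𝕜) • v i = (l 0 : 𝕜) • (∑ i, v i)
        + ∑ i : Fin n, ((l i.succ - l 0 : ℝ) : 𝕜) • v i.succ := by
      rw [Fin.sum_univ_succ, Fin.sum_univ_succ, smul_add, smul_sum, add_assoc,
        ← sum_add_distrib]
      congr 1
      refine sum_congr rfl fun i _ => ?_
      rw [← add_smul]
      push_cast
      congr 1
      ring
    rw [heq]
    refine (norm_add_le _ _).trans ?_
    rw [norm_smul, RCLike.norm_ofReal, abs_of_nonneg (h0 0)]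
    nlinarith [mul_le_mul_of_nonneg_left h2 (h0 0)]

variable [RCLike 𝕜] [NormedAddCommGroup X] [NormedSpace 𝕜 X] [CompleteSpace X]

/-- Boundedness of multipliers: for a `C`-suppression quasi-greedy system, a non-decreasing
multiplier with values in `[0,1]` applied to coefficients with non-increasing moduli. -/
theorem stmt_4 (hX : ¬ FiniteDimensional 𝕜 X) (e : ℕ → X) (f : ℕ → X →L[𝕜] 𝕜)
    (hsys : BiorthSystem 𝕜 e f) (C : ℝ) (hC : 1 ≤ C)
    (hqg : SuppressionQuasiGreedyWith e f C)
    (N : ℕ) (ρ : Fin N → ℕ) (hρ : Function.Injective ρ)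
    (a : Fin N → 𝕜) (ha : ∀ i j : Fin N, i ≤ j → ‖a j‖ ≤ ‖a i‖)
    (l : Fin N → ℝ) (hl0 : ∀ i, 0 ≤ l i) (hl1 : ∀ i, l i ≤ 1)
    (hlmono : ∀ i j : Fin N, i ≤ j → l i ≤ l j) :
    ‖∑ i, ((l i : 𝕜) * a i) • e (ρ i)‖ ≤ C * ‖∑ i, a i • e (ρ i)‖ := by
  obtain ⟨hb, -, -⟩ := hsys
  have hco : ∀ j, f (ρ j) (∑ i, a i • e (ρ i)) = a j := by
    intro j
    rw [map_sum, Finset.sum_eq_single j]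
    · simp [hb]
    · intro i _ hij
      have : ρ j ≠ ρ i := fun h => hij (hρ h).symm
      simp [hb, this]
    · simp
  have hco' : ∀ k, (∀ j, ρ j ≠ k) → f k (∑ i, a i • e (ρ i)) = 0 := by
    intro k hk
    rw [map_sum]
    refine Finset.sum_eq_zero fun i _ => ?_
    simp [hb, (hk i).symm]
  have key := abel_tails (𝕜 := 𝕜) (C * ‖∑ i, a i • e (ρ i)‖) (by positivity) N
    (fun i => a i • e (ρ i)) l 1 zero_le_one hl0 hl1 hlmono (by
      intro m
      have h := hqg (∑ i, a i • e (ρ i)) ((univ.filter (fun i => i < m)).image ρ) (by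
        intro n hn k hk
        simp only [mem_image, mem_filter, mem_univ, true_and] at hn hk
        obtain ⟨i, hi, rfl⟩ := hn
        by_cases hk' : ∃ j, ρ j = k
        · obtain ⟨j, rfl⟩ := hk'
          rw [hco, hco]
          apply ha
          by_contra hji
          exact hk ⟨j, (not_le.1 hji).trans hi, rfl⟩
        · push Not at hk'
          rw [hco' k hk']
          simp)
      unfold greedyProj at h
      rw [Finset.sum_image (fun _ _ _ _ h => hρ h)] at h
      simp only [hco] at h
      convert h using 2
      rw [Finset.sum_filter, ← Finset.sum_sub_distrib]
      refine Finset.sum_congr rfl fun i _ => ?_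
      by_cases hi : m ≤ i
      · simp [hi, not_lt.2 hi]
      · simp [hi, not_le.1 hi])
  simpa [smul_smul] using key
end

section
/- Let (e_n, e_n*) be a semi-normalized bounded biorthogonal system in an infinite-dimensional Banach space X and let K, C ≥ 1. If the system is K-suppression unconditional and C-symmetric for largest coefficients, then it is C·K-greedy. -/
open Finset

variable {𝕜 X : Type*}

section Helpers

theorem aux_conv [RCLike 𝕜] [NormedAddCommGroup X] [NormedSpace 𝕜 X] (v : ℕ → X) (M : ℝ)
    (μ : ℕ → ℝ) (A : Finset ℕ) (hμ : ∀ n ∈ A, 0 ≤ μ n ∧ μ n ≤ 1) :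
    ∀ w : X, (∀ D ⊆ A, ‖w - ∑ n ∈ D, v n‖ ≤ M) →
      ‖w - ∑ n ∈ A, ((μ n : ℝ) : 𝕜) • v n‖ ≤ M := by
  induction A using Finset.induction_on with
  | empty => intro w h; simpa using h ∅ (by simp)
  | insert a s ha ih =>
    intro w h
    have ih' := ih (fun n hn => hμ n (by simp [hn]))
    obtain ⟨h0, h1⟩ := hμ a (by simp)
    have e1 := ih' w (fun D hD => h D (hD.trans (by simp)))
    have e2 := ih' (w - v a) (fun D hD => by
      have := h (insert a D) (Finset.insert_subset_insert a hD)
      rw [Finset.sum_insert (fun h => ha (hD h))] at this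
      rwa [sub_sub])
    rw [Finset.sum_insert ha]
    set S := ∑ n ∈ s, ((μ n : ℝ) : 𝕜) • v n
    have key : w - (((μ a : ℝ) : 𝕜) • v a + S)
        = ((1 - μ a : ℝ) : 𝕜) • (w - S) + ((μ a : ℝ) : 𝕜) • (w - v a - S) := by
      push_cast; module
    rw [key]
    refine (norm_add_le _ _).trans ?_
    rw [norm_smul, norm_smul, RCLike.norm_ofReal, RCLike.norm_ofReal,
      abs_of_nonneg h0, abs_of_nonneg (by linarith)]
    nlinarith

theorem aux_sign_s7 [RCLike 𝕜] [NormedAddCommGroup X] [NormedSpace 𝕜 X] (v : ℕ → X) (M : ℝ)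
    (a : ℕ → 𝕜) (A : Finset ℕ) (hμ : ∀ n ∈ A, ‖a n‖ ≤ 1) :
    ∀ w : X, (∀ θ : ℕ → 𝕜, (∀ n ∈ A, ‖θ n‖ = 1) → ‖w + ∑ n ∈ A, θ n • v n‖ ≤ M) →
      ‖w + ∑ n ∈ A, a n • v n‖ ≤ M := by
  induction A using Finset.induction_on with
  | empty => intro w h; simpa using h 1 (by simp)
  | insert b s hb ih =>
    intro w h
    have ih' := ih (fun n hn => hμ n (by simp [hn]))
    have h1 := hμ b (by simp)
    have gen : ∀ c : 𝕜, ‖c‖ = 1 → ‖(w + c • v b) + ∑ n ∈ s, a n • v n‖ ≤ M := by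
      intro c hc
      apply ih'
      intro θ hθ
      have := h (Function.update θ b c) (by
        intro n hn
        by_cases hnb : n = b
        · subst hnb; simpa using hc
        · rw [Function.update_of_ne hnb]
          exact hθ n ((Finset.mem_insert.1 hn).resolve_left hnb))
      rw [Finset.sum_insert hb, Function.update_self] at this
      rw [add_assoc]
      convert this using 4
      refine Finset.sum_congr rfl fun n hn => ?_
      rw [Function.update_of_ne]
      rintro rfl; exact hb hn
    obtain ⟨c, hc, hac⟩ : ∃ c : 𝕜, ‖c‖ = 1 ∧ a b = ((‖a b‖ : ℝ) : 𝕜) * c := by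
      by_cases h0 : a b = 0
      · exact ⟨1, by simp, by simp [h0]⟩
      · have : ((‖a b‖ : ℝ) : 𝕜) ≠ 0 := by simpa using h0
        exact ⟨a b / ((‖a b‖ : ℝ) : 𝕜), by simp [h0], by field_simp⟩
    have g1 := gen c hc
    have g2 := gen (-c) (by simpa using hc)
    rw [Finset.sum_insert hb, hac]
    have hr := norm_nonneg (a b)
    generalize ‖a b‖ = r at *
    set S := ∑ n ∈ s, a n • v n
    have key : w + (((r : 𝕜) * c) • v b + S)
        = (((1 + r) / 2 : ℝ) : 𝕜) • ((w + c • v b) + S)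
          + (((1 - r) / 2 : ℝ) : 𝕜) • ((w + (-c) • v b) + S) := by
      push_cast; module
    rw [key]
    refine (norm_add_le _ _).trans ?_
    rw [norm_smul, norm_smul, RCLike.norm_ofReal, RCLike.norm_ofReal,
      abs_of_nonneg (by linarith), abs_of_nonneg (by linarith)]
    nlinarith

end Helpers

variable [RCLike 𝕜] [NormedAddCommGroup X] [NormedSpace 𝕜 X] [CompleteSpace X]

/-- If the system is `K`-suppression unconditional and `C`-symmetric for largest coefficients
then it is `C*K`-greedy. -/
theorem stmt_7 (hX : ¬ FiniteDimensional 𝕜 X) (e : ℕ → X) (f : ℕ → X →L[𝕜] 𝕜)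
    (hsys : BiorthSystem 𝕜 e f) (K C : ℝ) (hK : 1 ≤ K) (hC : 1 ≤ C)
    (hsu : SuppressionUnconditionalWith e f K)
    (hslc : SymmetricLargestCoeffsWith e f C) :
    GreedyWith e f (C * K) := by
  obtain ⟨hbi, -, -⟩ := hsys
  intro x A hA B hcard α
  have hfs : ∀ (D : Finset ℕ) (c : ℕ → 𝕜) (n : ℕ),
      f n (∑ k ∈ D, c k • e k) = if n ∈ D then c n else 0 := by
    intro D c n
    simp [map_sum, hbi]
  set y := x - ∑ n ∈ B, α n • e n with hy
  have hyn : ∀ n, n ∉ B → f n y = f n x := by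
    intro n hn
    rw [hy, map_sub, hfs, if_neg hn, sub_zero]
  -- suppressing `B` and a subset of `A \ B` in `y`
  have hsupp : ∀ D, D ⊆ A \ B →
      ‖(x - ∑ n ∈ B, f n x • e n) - ∑ n ∈ D, f n x • e n‖ ≤ K * ‖y‖ := by
    intro D hD
    have hdis : Disjoint B D := by
      rw [Finset.disjoint_left]
      intro n hnB hnD
      exact (Finset.mem_sdiff.1 (hD hnD)).2 hnB
    have h := hsu y (B ∪ D)
    have h2 : y - greedyProj e f (B ∪ D) y
        = (x - ∑ n ∈ B, f n x • e n) - ∑ n ∈ D, f n x • e n := by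
      unfold greedyProj
      rw [Finset.sum_union hdis]
      have e1 : ∑ n ∈ D, f n y • e n = ∑ n ∈ D, f n x • e n :=
        Finset.sum_congr rfl fun n hn => by
          rw [hyn n (Finset.mem_sdiff.1 (hD hn)).2]
      have e2 : ∑ n ∈ B, f n y • e n = ∑ n ∈ B, f n x • e n - ∑ n ∈ B, α n • e n := by
        rw [← Finset.sum_sub_distrib]
        refine Finset.sum_congr rfl fun n hn => ?_
        rw [hy, map_sub, hfs, if_pos hn, sub_smul]
      rw [e1, e2, hy]; abel
    rwa [h2] at h
  have hKy : 0 ≤ K * ‖y‖ := by positivity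
  rcases (A \ B).eq_empty_or_nonempty with hemp | hne
  · have hAB : A = B := Finset.eq_of_subset_of_card_le
      (Finset.sdiff_eq_empty_iff_subset.1 hemp) hcard.le
    have h := hsupp ∅ (by simp)
    simp only [Finset.sum_empty, sub_zero] at h
    unfold greedyProj
    rw [hAB]
    nlinarith
  obtain ⟨m, hm, hmin⟩ := Finset.exists_min_image (A \ B) (fun n => ‖f n x‖) hne
  have hmA := (Finset.mem_sdiff.1 hm).1
  set t : ℝ := ‖f m x‖ with ht
  have ht0 : 0 ≤ t := norm_nonneg _
  have hnt : ‖(t : 𝕜)‖ = t := by rw [RCLike.norm_ofReal, abs_of_nonneg ht0]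
  set z := x - ∑ n ∈ A ∪ B, f n x • e n with hz
  have hfz : ∀ n, f n z = if n ∈ A ∪ B then 0 else f n x := by
    intro n
    rw [hz, map_sub, hfs]
    split_ifs <;> simp
  let ε : ℕ → 𝕜 := fun n => if f n x = 0 then 1 else f n x / ((‖f n x‖ : ℝ) : 𝕜)
  have hε : ∀ n, ‖ε n‖ = 1 := by
    intro n
    by_cases h0 : f n x = 0 <;> simp [ε, h0]
  -- the truncated vector
  have htr : ‖z + (t : 𝕜) • ∑ n ∈ A \ B, ε n • e n‖ ≤ K * ‖y‖ := by
    have h := aux_conv (𝕜 := 𝕜) (fun n => f n x • e n) (K * ‖y‖)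
      (fun n => 1 - t / ‖f n x‖) (A \ B) (fun n hn => by
        have h1 : t / ‖f n x‖ ≤ 1 := div_le_one_of_le₀ (hmin n hn) (norm_nonneg _)
        have h2 : 0 ≤ t / ‖f n x‖ := by positivity
        constructor <;> linarith) _ hsupp
    convert h using 2
    have e1 : ∑ n ∈ A ∪ B, f n x • e n
        = ∑ n ∈ B, f n x • e n + ∑ n ∈ A \ B, f n x • e n := by
      rw [← Finset.sum_union Finset.disjoint_sdiff, Finset.union_sdiff_self_eq_union,
        Finset.union_comm]
    have e2 : ∑ n ∈ A \ B, (((1 - t / ‖f n x‖ : ℝ)) : 𝕜) • f n x • e n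
        = ∑ n ∈ A \ B, f n x • e n - (t : 𝕜) • ∑ n ∈ A \ B, ε n • e n := by
      rw [Finset.smul_sum, ← Finset.sum_sub_distrib]
      refine Finset.sum_congr rfl fun n hn => ?_
      by_cases h0 : f n x = 0
      · have : t = 0 := le_antisymm (by simpa [h0] using hmin n hn) ht0
        simp [h0, this]
      · simp only [ε, h0, if_false]
        rw [smul_smul, smul_smul, ← sub_smul]
        congr 1
        push_cast
        ring
    rw [hz, e1, e2]; abel
  have hsym : ‖z + ∑ n ∈ B \ A, (f n x / (t : 𝕜)) • ((t : 𝕜) • e n)‖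
      ≤ C * ‖z + (t : 𝕜) • ∑ n ∈ A \ B, ε n • e n‖ := by
    apply aux_sign_s7
    · intro n hn
      rw [norm_div, hnt]
      exact div_le_one_of_le₀ (hA m hmA n (Finset.mem_sdiff.1 hn).2) ht0
    · intro θ hθ
      have h := hslc z (A \ B) (B \ A) disjoint_sdiff_sdiff
        (Finset.card_sdiff_comm hcard.symm) (by
          intro n hn
          rw [hfz, if_pos]
          simp only [Finset.mem_union, Finset.mem_sdiff] at hn ⊢
          tauto) ε θ (fun n _ => hε n) hθ (t : 𝕜) (by
          intro n
          rw [hfz, hnt]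
          split_ifs with hn
          · simpa using ht0
          · exact hA m hmA n (fun h => hn (Finset.mem_union_left _ h)))
      convert h using 3
      rw [Finset.smul_sum]
      exact Finset.sum_congr rfl fun n _ => smul_comm _ _ _
  have hfin : x - greedyProj e f A x
      = z + ∑ n ∈ B \ A, (f n x / (t : 𝕜)) • ((t : 𝕜) • e n) := by
    have e1 : ∑ n ∈ B \ A, (f n x / (t : 𝕜)) • ((t : 𝕜) • e n)
        = ∑ n ∈ B \ A, f n x • e n := by
      refine Finset.sum_congr rfl fun n hn => ?_
      rw [smul_smul]
      by_cases h0 : t = 0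
      · have h1 : ‖f n x‖ ≤ t := hA m hmA n (Finset.mem_sdiff.1 hn).2
        rw [h0] at h1
        have : f n x = 0 := norm_le_zero_iff.1 h1
        simp [this]
      · rw [div_mul_cancel₀ _ (by exact_mod_cast h0)]
    have e2 : ∑ n ∈ A ∪ B, f n x • e n
        = ∑ n ∈ A, f n x • e n + ∑ n ∈ B \ A, f n x • e n := by
      rw [← Finset.sum_union Finset.disjoint_sdiff, Finset.union_sdiff_self_eq_union]
    unfold greedyProj
    rw [e1, hz, e2]; abel
  rw [hfin, mul_assoc]
  exact hsym.trans (mul_le_mul_of_nonneg_left htr (by linarith))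
end

section
/- Let (e_n, e_n*) be a semi-normalized bounded biorthogonal system in an infinite-dimensional Banach space X which is C-symmetric for largest coefficients for some C ≥ 1. Then for every z ∈ X, all finite sets A, B ⊆ ℕ (not necessarily disjoint) with |A| = |B| and (A ∪ B) ∩ supp(z) = ∅, all scalars (ε_n)_{n∈A} and (θ_n)_{n∈B} of modulus 1, and every scalar t with |e_n*(z)| ≤ |t| for all n, one has ‖z + t ∑_{n∈B} θ_n e_n‖ ≤ C² ‖z + t ∑_{n∈A} ε_n e_n‖. -/
open Finset

variable {𝕜 X : Type*}

variable [RCLike 𝕜] [NormedAddCommGroup X] [NormedSpace 𝕜 X] [CompleteSpace X]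

/-- Coefficients tend to zero: eventually they are small. -/
theorem coeff_eventually_small (e : ℕ → X) (f : ℕ → X →L[𝕜] 𝕜)
    (hsys : BiorthSystem 𝕜 e f) (z : X) (δ : ℝ) (hδ : 0 < δ) :
    ∃ N, ∀ n ≥ N, ‖f n z‖ ≤ δ := by
  obtain ⟨hb, hd, M, hM⟩ := hsys
  have hM0 : 0 ≤ M := (norm_nonneg _).trans (hM 0).1
  have hspan : ∀ y ∈ Submodule.span 𝕜 (Set.range e), ∃ N, ∀ n ≥ N, f n y = 0 := by
    intro y hy
    induction hy using Submodule.span_induction with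
    | mem x hx =>
      obtain ⟨k, rfl⟩ := hx
      refine ⟨k + 1, fun n hn => ?_⟩
      rw [hb, if_neg (by omega)]
    | zero => exact ⟨0, fun n _ => by simp⟩
    | add x y _ _ hx hy =>
      obtain ⟨N, hN⟩ := hx
      obtain ⟨N', hN'⟩ := hy
      refine ⟨max N N', fun n hn => ?_⟩
      rw [map_add, hN n (le_trans (le_max_left _ _) hn),
        hN' n (le_trans (le_max_right _ _) hn), add_zero]
    | smul a x _ hx =>
      obtain ⟨N, hN⟩ := hx
      exact ⟨N, fun n hn => by rw [map_smul, hN n hn, smul_zero]⟩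
  have hzc : z ∈ closure (Submodule.span 𝕜 (Set.range e) : Set X) := by
    rw [← Submodule.topologicalClosure_coe, hd]; trivial
  obtain ⟨y, hy, hyz⟩ := Metric.mem_closure_iff.1 hzc (δ / (M + 1)) (by positivity)
  obtain ⟨N, hN⟩ := hspan y hy
  refine ⟨N, fun n hn => ?_⟩
  have h1 : f n z = f n (z - y) := by rw [map_sub, hN n hn, sub_zero]
  rw [dist_eq_norm] at hyz
  rw [h1]
  calc ‖f n (z - y)‖ ≤ ‖f n‖ * ‖z - y‖ := (f n).le_opNorm _
    _ ≤ (M + 1) * (δ / (M + 1)) := by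
        gcongr
        linarith [(hM n).2]
    _ = δ := by field_simp

/-- If the system is `C`-symmetric for largest coefficients and `y` is a (not necessarily
disjoint) greedy permutation of `x`, then `‖y‖ ≤ C² ‖x‖`. -/
theorem stmt_9 (hX : ¬ FiniteDimensional 𝕜 X) (e : ℕ → X) (f : ℕ → X →L[𝕜] 𝕜)
    (hsys : BiorthSystem 𝕜 e f) (C : ℝ) (hC : 1 ≤ C)
    (hslc : SymmetricLargestCoeffsWith e f C)
    (z : X) (A B : Finset ℕ) (hcard : A.card = B.card)
    (hz : ∀ n ∈ A ∪ B, f n z = 0)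
    (ε θ : ℕ → 𝕜) (hε : ∀ n ∈ A, ‖ε n‖ = 1) (hθ : ∀ n ∈ B, ‖θ n‖ = 1)
    (t : 𝕜) (ht : ∀ n, ‖f n z‖ ≤ ‖t‖) :
    ‖z + t • ∑ n ∈ B, θ n • e n‖ ≤ C ^ 2 * ‖z + t • ∑ n ∈ A, ε n • e n‖ := by
  obtain ⟨hb, hd, M, hM⟩ := id hsys
  have hM0 : 0 ≤ M := (norm_nonneg _).trans (hM 0).1
  have hC0 : 0 ≤ C := by linarith
  refine le_of_forall_pos_le_add fun η hη => ?_
  set K : ℝ := A.card * M * (1 + C ^ 2) with hK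
  have hK0 : 0 ≤ K := by positivity
  obtain ⟨N, hN⟩ := coeff_eventually_small e f hsys z (η / (K + 1)) (by positivity)
  set δ := η / (K + 1) with hδ
  have hδ0 : 0 ≤ δ := by positivity
  obtain ⟨L, hL⟩ : ∃ L, ∀ n ∈ A ∪ B, n < L :=
    ⟨(A ∪ B).sup id + 1, fun n hn => Nat.lt_succ_of_le (Finset.le_sup (f := id) hn)⟩
  set m := max N L with hm
  set D : Finset ℕ := Finset.Ico m (m + A.card) with hD
  have hDc : D.card = A.card := by simp [hD]
  have hDm : ∀ n ∈ D, N ≤ n ∧ L ≤ n := by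
    intro n hn
    have := (Finset.mem_Ico.1 hn).1
    omega
  have hdis : Disjoint (A ∪ B) D := by
    rw [Finset.disjoint_left]
    intro n hn hn'
    have := hL n hn
    have := (hDm n hn').2
    omega
  have hAD : Disjoint A D := Finset.disjoint_of_subset_left Finset.subset_union_left hdis
  have hBD : Disjoint B D := Finset.disjoint_of_subset_left Finset.subset_union_right hdis
  set w : X := ∑ n ∈ D, f n z • e n with hw
  have hfw : ∀ n, f n w = if n ∈ D then f n z else 0 := by
    intro n
    simp [hw, map_sum, hb]
  have hwn : ‖w‖ ≤ A.card * M * δ := by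
    calc ‖w‖ ≤ ∑ n ∈ D, δ * M := by
          refine norm_sum_le_of_le _ fun n hn => ?_
          rw [norm_smul]
          exact mul_le_mul (hN n (hDm n hn).1) (hM n).1 (norm_nonneg _) hδ0
      _ = A.card * M * δ := by rw [Finset.sum_const, hDc, nsmul_eq_mul]; ring
  have hz'D : ∀ n ∈ D, f n (z - w) = 0 := by
    intro n hn
    rw [map_sub, hfw, if_pos hn, sub_self]
  have hz'AB : ∀ n ∈ A ∪ B, f n (z - w) = 0 := by
    intro n hn
    rw [map_sub, hfw, if_neg (Finset.disjoint_left.1 hdis hn), hz n hn, sub_self]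
  have ht' : ∀ n, ‖f n (z - w)‖ ≤ ‖t‖ := by
    intro n
    by_cases hn : n ∈ D
    · rw [hz'D n hn, norm_zero]; exact norm_nonneg _
    · rw [map_sub, hfw, if_neg hn, sub_zero]; exact ht n
  have h1 := hslc (z - w) A D hAD hDc.symm
    (fun n hn => (Finset.mem_union.1 hn).elim
      (fun h => hz'AB n (Finset.mem_union_left _ h)) (hz'D n))
    ε (fun _ => 1) hε (fun _ _ => norm_one) t ht'
  have h2 := hslc (z - w) D B hBD.symm (hDc.trans hcard)
    (fun n hn => (Finset.mem_union.1 hn).elim (hz'D n)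
      (fun h => hz'AB n (Finset.mem_union_right _ h)))
    (fun _ => 1) θ (fun _ _ => norm_one) hθ t ht'
  have h3 := h2.trans (mul_le_mul_of_nonneg_left h1 hC0)
  set a := t • ∑ n ∈ A, ε n • e n
  set b := t • ∑ n ∈ B, θ n • e n
  have h4 : ‖z + b‖ ≤ ‖z - w + b‖ + ‖w‖ := by
    have := norm_add_le (z - w + b) w
    rwa [show z - w + b + w = z + b by abel] at this
  have h5 : ‖z - w + a‖ ≤ ‖z + a‖ + ‖w‖ := by
    have := norm_sub_le (z + a) w
    rwa [show z + a - w = z - w + a by abel] at this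
  have h6 : K * δ ≤ η := by
    rw [hδ, mul_div_assoc', div_le_iff₀ (by positivity)]
    nlinarith
  have h7 : C ^ 2 * ‖z - w + a‖ ≤ C ^ 2 * (‖z + a‖ + ‖w‖) :=
    mul_le_mul_of_nonneg_left h5 (by positivity)
  have h8 : (1 + C ^ 2) * ‖w‖ ≤ (1 + C ^ 2) * (A.card * M * δ) :=
    mul_le_mul_of_nonneg_left hwn (by positivity)
  have h9 : (1 + C ^ 2) * (A.card * M * δ) = K * δ := by rw [hK]; ring
  nlinarith
end

section
/- Let (e_n, e_n*) be a semi-normalized bounded biorthogonal system in an infinite-dimensional Banach space X. If the system has Property (A), then it is 1-suppression quasi-greedy, i.e., ‖x − P_A(x)‖ ≤ ‖x‖ for every x ∈ X and every greedy set A for x. -/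
open Finset

variable {𝕜 X : Type*}

variable [RCLike 𝕜] [NormedAddCommGroup X] [NormedSpace 𝕜 X] [CompleteSpace X]

theorem aux_tendsto (e : ℕ → X) (f : ℕ → X →L[𝕜] 𝕜)
    (hsys : BiorthSystem 𝕜 e f) (z : X) :
    Filter.Tendsto (fun k => ‖f k z‖) Filter.atTop (nhds 0) := by
  obtain ⟨hb, hd, M, hM⟩ := hsys
  have hM0 : 0 ≤ M := (norm_nonneg _).trans (hM 0).1
  have hev : ∀ v ∈ Submodule.span 𝕜 (Set.range e), ∀ᶠ k in Filter.atTop, f k v = 0 := by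
    intro v hv
    induction hv using Submodule.span_induction with
    | mem x hx =>
      obtain ⟨m, rfl⟩ := hx
      filter_upwards [Filter.eventually_gt_atTop m] with k hk
      rw [hb, if_neg (by omega)]
    | zero => simp
    | add x y _ _ hx hy =>
      filter_upwards [hx, hy] with k h1 h2
      simp [h1, h2]
    | smul a x _ hx =>
      filter_upwards [hx] with k h1
      simp [h1]
  have hz : z ∈ closure (Submodule.span 𝕜 (Set.range e) : Set X) := by
    rw [← Submodule.topologicalClosure_coe, hd]; trivial
  rw [Metric.tendsto_nhds]
  intro δ hδ
  obtain ⟨v, hv, hvz⟩ := Metric.mem_closure_iff.1 hz (δ / (M + 1)) (by positivity)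
  filter_upwards [hev v hv] with k hk
  have h1 : f k z = f k (z - v) := by simp [hk]
  have h2 : ‖f k (z - v)‖ ≤ M * ‖z - v‖ :=
    (f k).le_of_opNorm_le (hM k).2 _
  rw [dist_eq_norm] at hvz
  rw [lt_div_iff₀ (by positivity)] at hvz
  simp only [dist_zero_right, norm_norm]
  rw [h1]
  nlinarith [norm_nonneg (z - v)]

theorem aux_single (e : ℕ → X) (f : ℕ → X →L[𝕜] 𝕜)
    (hsys : BiorthSystem 𝕜 e f) (hA : SymmetricLargestCoeffsWith e f 1)
    (x : X) (j : ℕ) (hj : ∀ k, ‖f k x‖ ≤ ‖f j x‖) : ‖x - f j x • e j‖ ≤ ‖x‖ := by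
  have ht := aux_tendsto e f hsys (x - f j x • e j)
  obtain ⟨hb, hd, M, hM⟩ := hsys
  have hM0 : 0 ≤ M := (norm_nonneg _).trans (hM 0).1
  set t := f j x with ht_def
  set z := x - t • e j with hz
  have hzj : f j z = 0 := by simp [hz, hb, ht_def]
  have hzk : ∀ n, ‖f n z‖ ≤ ‖t‖ := by
    intro n
    by_cases h : n = j
    · subst h; simp [hzj]
    · have : f n z = f n x := by simp [hz, hb, h]
      rw [this]; exact hj n
  have key : ∀ᶠ k in Filter.atTop, ‖z‖ ≤ ‖x‖ + 2 * M * ‖f k z‖ := by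
    filter_upwards [Filter.eventually_gt_atTop j] with k hk
    set w := z - f k z • e k with hw
    have hwj : f j w = 0 := by simp [hw, hb, hzj, hk.ne]
    have hwk : f k w = 0 := by simp [hw, hb]
    have hwn : ∀ n, ‖f n w‖ ≤ ‖t‖ := by
      intro n
      by_cases h : n = k
      · subst h; simp [hwk]
      · have : f n w = f n z := by simp [hw, hb, h]
        rw [this]; exact hzk n
    have H : ∀ s : 𝕜, ‖s‖ = 1 → ‖w + t • s • e k‖ ≤ ‖w + t • e j‖ := by
      intro s hs
      have := hA w {j} {k} (by simp [hk.ne]) (by simp)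
        (by simp [hwj, hwk]) (fun _ => 1) (fun _ => s) (by simp) (by simp [hs]) t hwn
      simpa using this
    have H1 := H 1 (by simp)
    have H2 := H (-1) (by simp)
    have h3 : ‖(2 : 𝕜) • w‖ ≤ ‖w + t • (1 : 𝕜) • e k‖ + ‖w + t • (-1 : 𝕜) • e k‖ := by
      refine le_trans (le_of_eq ?_) (norm_add_le _ _)
      congr 1
      module
    rw [norm_smul, RCLike.norm_ofNat] at h3
    have h4 : ‖f k z • e k‖ ≤ M * ‖f k z‖ := by
      rw [norm_smul, mul_comm]
      exact mul_le_mul_of_nonneg_right (hM k).1 (norm_nonneg _)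
    have h5 : ‖z‖ ≤ ‖w‖ + ‖f k z • e k‖ := by
      refine le_trans (le_of_eq ?_) (norm_add_le _ _)
      congr 1
      simp [hw]
    have h6 : ‖w + t • e j‖ ≤ ‖x‖ + ‖f k z • e k‖ := by
      refine le_trans (le_of_eq ?_) (norm_sub_le _ _)
      congr 1
      rw [hw, hz]; abel
    linarith
  have hlim : Filter.Tendsto (fun k => ‖x‖ + 2 * M * ‖f k z‖) Filter.atTop (nhds ‖x‖) := by
    simpa using (ht.const_mul (2 * M)).const_add ‖x‖
  exact ge_of_tendsto hlim key

/-- If the system has Property (A) then it is `1`-suppression quasi-greedy. -/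
theorem stmt_10 (hX : ¬ FiniteDimensional 𝕜 X) (e : ℕ → X) (f : ℕ → X →L[𝕜] 𝕜)
    (hsys : BiorthSystem 𝕜 e f)
    (hA : SymmetricLargestCoeffsWith e f 1) :
    ∀ (x : X) (A : Finset ℕ), IsGreedySet f x A → ‖x - greedyProj e f A x‖ ≤ ‖x‖ := by
  intro x A
  induction hc : A.card generalizing x A with
  | zero =>
    intro _
    rw [Finset.card_eq_zero] at hc
    simp [hc, greedyProj]
  | succ m ih =>
    intro hG
    have hne : A.Nonempty := by
      rw [← Finset.card_pos]; omega
    obtain ⟨j, hjA, hjmax⟩ := A.exists_max_image (fun n => ‖f n x‖) hne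
    have hj : ∀ k, ‖f k x‖ ≤ ‖f j x‖ := by
      intro k
      by_cases hk : k ∈ A
      · exact hjmax k hk
      · exact hG j hjA k hk
    have h1 := aux_single e f hsys hA x j hj
    have hb := hsys.1
    have hcoef : ∀ n, n ≠ j → f n (x - f j x • e j) = f n x := by
      intro n hn
      simp [hb, hn]
    have hcj : f j (x - f j x • e j) = 0 := by simp [hb]
    have h2 := ih (x - f j x • e j) (A.erase j)
      (by rw [Finset.card_erase_of_mem hjA]; omega) (by
        intro n hn k hk
        rw [Finset.mem_erase] at hn hk
        by_cases hkj : k = j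
        · subst hkj; rw [hcj]; simp
        · rw [hcoef k hkj, hcoef n hn.1]
          exact hG n hn.2 k (fun h => hk ⟨hkj, h⟩))
    have h3 : x - greedyProj e f A x
        = x - f j x • e j - greedyProj e f (A.erase j) (x - f j x • e j) := by
      have : greedyProj e f (A.erase j) (x - f j x • e j)
          = ∑ n ∈ A.erase j, f n x • e n := by
        refine Finset.sum_congr rfl fun n hn => ?_
        rw [hcoef n (Finset.ne_of_mem_erase hn)]
      rw [this, greedyProj, ← Finset.add_sum_erase A _ hjA]
      abel
    rw [h3]
    exact h2.trans h1
end

section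
/- Let (e_n, e_n*) be a semi-normalized bounded biorthogonal system in an infinite-dimensional Banach space X and let C ≥ 1. If the system is C-greedy, then it is C-suppression unconditional and C-symmetric for largest coefficients. -/
open Finset

variable {𝕜 X : Type*}

variable [RCLike 𝕜] [NormedAddCommGroup X] [NormedSpace 𝕜 X] [CompleteSpace X]

/-- Coefficients of a finite combination of the basis vectors. -/
theorem coeff_sum_aux (e : ℕ → X) (f : ℕ → X →L[𝕜] 𝕜)
    (hb : ∀ n k, f n (e k) = if n = k then (1 : 𝕜) else 0) (A : Finset ℕ) (a : ℕ → 𝕜) (k : ℕ) :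
    f k (∑ n ∈ A, a n • e n) = if k ∈ A then a k else 0 := by
  simp [map_sum, hb]

/-- If the system is `C`-greedy then it is `C`-suppression unconditional and `C`-symmetric
for largest coefficients. -/
theorem stmt_12 (hX : ¬ FiniteDimensional 𝕜 X) (e : ℕ → X) (f : ℕ → X →L[𝕜] 𝕜)
    (hsys : BiorthSystem 𝕜 e f) (C : ℝ) (hC : 1 ≤ C)
    (hg : GreedyWith e f C) :
    SuppressionUnconditionalWith e f C ∧ SymmetricLargestCoeffsWith e f C := by
  obtain ⟨hb, -, M, hM⟩ := hsys
  have hc := coeff_sum_aux e f hb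
  constructor
  · intro x A
    set s : ℝ := M * ‖x‖ with hs
    have hle : ∀ n, ‖f n x‖ ≤ s := fun n =>
      ((f n).le_opNorm x).trans (mul_le_mul_of_nonneg_right (hM n).2 (norm_nonneg _))
    have hs0 : 0 ≤ s := (norm_nonneg _).trans (hle 0)
    set y : X := x + ∑ n ∈ A, ((s : 𝕜) - f n x) • e n with hy
    have hfy : ∀ k, f k y = if k ∈ A then (s : 𝕜) else f k x := by
      intro k
      rw [hy, map_add, hc A (fun n => (s : 𝕜) - f n x)]
      split_ifs <;> simp
    have hgr : IsGreedySet f y A := by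
      intro n hn k hk
      rw [hfy, hfy, if_pos hn, if_neg hk, RCLike.norm_ofReal, abs_of_nonneg hs0]
      exact hle k
    have h := hg y A hgr A rfl (fun n => (s : 𝕜) - f n x)
    have h1 : greedyProj e f A y = ∑ n ∈ A, (s : 𝕜) • e n :=
      Finset.sum_congr rfl (fun n hn => by rw [hfy, if_pos hn])
    have h2 : y - greedyProj e f A y = x - greedyProj e f A x := by
      rw [h1, hy]
      simp only [greedyProj, sub_smul, Finset.sum_sub_distrib]
      abel
    rw [h2] at h
    simpa [hy] using h
  · intro z A B hAB hcard hz ε θ hε hθ t ht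
    set a : X := ∑ n ∈ A, (t * ε n) • e n with ha
    set b : X := ∑ n ∈ B, (t * θ n) • e n with hbdef
    have ha' : t • ∑ n ∈ A, ε n • e n = a := by
      simp [ha, Finset.smul_sum, mul_smul]
    have hb' : t • ∑ n ∈ B, θ n • e n = b := by
      simp [hbdef, Finset.smul_sum, mul_smul]
    rw [ha', hb']
    have hfA : ∀ k, f k a = if k ∈ A then t * ε k else 0 := hc A (fun n => t * ε n)
    have hfB : ∀ k, f k b = if k ∈ B then t * θ k else 0 := hc B (fun n => t * θ n)
    have hfw : ∀ n ∈ A, f n (z + a + b) = t * ε n := by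
      intro n hn
      have hnB : n ∉ B := Finset.disjoint_left.mp hAB hn
      rw [map_add, map_add, hfA, hfB, if_pos hn, if_neg hnB,
        hz n (Finset.mem_union_left _ hn)]
      simp
    have hgr : IsGreedySet f (z + a + b) A := by
      intro n hn k hk
      rw [hfw n hn, norm_mul, hε n hn, mul_one, map_add, map_add, hfA, hfB, if_neg hk]
      by_cases hkB : k ∈ B
      · rw [if_pos hkB, hz k (Finset.mem_union_right _ hkB)]
        simp [hθ k hkB]
      · rw [if_neg hkB]
        simpa using ht k
    have h := hg _ A hgr B hcard.symm (fun n => t * θ n)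
    have h1 : greedyProj e f A (z + a + b) = a :=
      Finset.sum_congr rfl (fun n hn => by rw [hfw n hn])
    rw [h1] at h
    have h2 : z + a + b - a = z + b := by abel
    have h3 : z + a + b - ∑ n ∈ B, (t * θ n) • e n = z + a := by
      rw [← hbdef]; abel
    rwa [h2, h3] at h
end

section
/- Let (e_n, e_n*) be a semi-normalized bounded biorthogonal system in an infinite-dimensional Banach space X. The following are equivalent: (i) ‖P_A(x)‖ ≤ ‖x‖ and ‖x − P_A(x)‖ ≤ ‖x‖ for every x ∈ X and every greedy set A for x; (ii) ‖P_A(x)‖ ≤ ‖x‖ for every x ∈ X and every greedy set A for x; (iii) ‖x − P_A(x)‖ ≤ ‖x‖ for every x ∈ X and every finite set A ⊆ ℕ (i.e., the system is 1-suppression unconditional). -/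
open Finset

variable {𝕜 X : Type*}

variable [RCLike 𝕜] [NormedAddCommGroup X] [NormedSpace 𝕜 X] [CompleteSpace X]

theorem aux_cont (e : ℕ → X) (f : ℕ → X →L[𝕜] 𝕜) (A : Finset ℕ) :
    Continuous (fun x => greedyProj e f A x) := by
  unfold greedyProj
  fun_prop

theorem aux_span (e : ℕ → X) (f : ℕ → X →L[𝕜] 𝕜)
    (hb : ∀ n k, f n (e k) = if n = k then (1 : 𝕜) else 0) (x : X)
    (hx : x ∈ Submodule.span 𝕜 (Set.range e)) :
    ∃ S : Finset ℕ, ∀ T : Finset ℕ, S ⊆ T → greedyProj e f T x = x := by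
  induction hx using Submodule.span_induction with
  | mem x h =>
    obtain ⟨n, rfl⟩ := h
    refine ⟨{n}, fun T hT => ?_⟩
    have hn : n ∈ T := hT (by simp)
    simp [greedyProj, hb, hn]
  | zero => exact ⟨∅, fun T _ => by simp [greedyProj]⟩
  | add x y _ _ hx hy =>
    obtain ⟨S, hS⟩ := hx
    obtain ⟨S', hS'⟩ := hy
    refine ⟨S ∪ S', fun T hT => ?_⟩
    have h1 := hS T (Finset.union_subset_left hT)
    have h2 := hS' T (Finset.union_subset_right hT)
    unfold greedyProj at *
    simp only [map_add, add_smul, Finset.sum_add_distrib, h1, h2]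
  | smul a x _ hx =>
    obtain ⟨S, hS⟩ := hx
    refine ⟨S, fun T hT => ?_⟩
    have h1 := hS T hT
    unfold greedyProj at *
    simp only [map_smul, smul_eq_mul, mul_smul, ← Finset.smul_sum, h1]

theorem aux_support (e : ℕ → X) (f : ℕ → X →L[𝕜] 𝕜)
    (hb : ∀ n k, f n (e k) = if n = k then (1 : 𝕜) else 0) (x : X)
    (hx : x ∈ Submodule.span 𝕜 (Set.range e)) :
    ∃ B : Finset ℕ, (∀ k, k ∈ B ↔ f k x ≠ 0) ∧ greedyProj e f B x = x := by
  classical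
  obtain ⟨S, hS⟩ := aux_span e f hb x hx
  have hS0 := hS S subset_rfl
  refine ⟨S.filter (fun k => f k x ≠ 0), fun k => ?_, ?_⟩
  · rw [Finset.mem_filter]
    refine ⟨fun h => h.2, fun h => ⟨?_, h⟩⟩
    by_contra hk
    apply h
    rw [← hS0]
    simp [greedyProj, hb, hk]
  · conv_rhs => rw [← hS0]
    unfold greedyProj
    apply Finset.sum_filter_of_ne
    intro k _ h h0
    apply h
    rw [h0, zero_smul]

theorem aux_dense (e : ℕ → X) (f : ℕ → X →L[𝕜] 𝕜) (hsys : BiorthSystem 𝕜 e f)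
    (p : X → Prop) (hp : IsClosed {x | p x})
    (h : ∀ x ∈ Submodule.span 𝕜 (Set.range e), p x) (x : X) : p x := by
  have hx : x ∈ (Submodule.span 𝕜 (Set.range e)).topologicalClosure := by
    rw [hsys.2.1]; trivial
  exact closure_minimal (s := (Submodule.span 𝕜 (Set.range e) : Set X)) h hp hx

theorem aux_proj (e : ℕ → X) (f : ℕ → X →L[𝕜] 𝕜) (hsys : BiorthSystem 𝕜 e f)
    (H : ∀ (x : X) (A : Finset ℕ), ‖x - greedyProj e f A x‖ ≤ ‖x‖) (A : Finset ℕ) (x : X) :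
    ‖greedyProj e f A x‖ ≤ ‖x‖ := by
  classical
  refine aux_dense e f hsys (fun x => ‖greedyProj e f A x‖ ≤ ‖x‖)
    (isClosed_le (aux_cont e f A).norm continuous_norm) (fun x hx => ?_) x
  obtain ⟨S, hS⟩ := aux_span e f hsys.1 x hx
  have h1 := hS (S ∪ A) Finset.subset_union_left
  have h2 : greedyProj e f ((S ∪ A) \ A) x + greedyProj e f A x = x := by
    conv_rhs => rw [← h1]
    exact Finset.sum_sdiff Finset.subset_union_right
  have h3 := H x ((S ∪ A) \ A)
  rwa [sub_eq_of_eq_add' h2.symm] at h3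

theorem aux_single_s14 (e : ℕ → X) (f : ℕ → X →L[𝕜] 𝕜) (hsys : BiorthSystem 𝕜 e f)
    (H : ∀ (x : X) (A : Finset ℕ), IsGreedySet f x A → ‖greedyProj e f A x‖ ≤ ‖x‖)
    (n : ℕ) (x : X) : ‖x - f n x • e n‖ ≤ ‖x‖ := by
  have hb := hsys.1
  refine aux_dense e f hsys (fun x => ‖x - f n x • e n‖ ≤ ‖x‖)
    (isClosed_le (by fun_prop) continuous_norm) (fun x hx => ?_) x
  obtain ⟨y, hy⟩ : ∃ y, y = x - f n x • e n := ⟨_, rfl⟩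
  obtain ⟨c, hc⟩ : ∃ c, c = f n x := ⟨_, rfl⟩
  have hys : y ∈ Submodule.span 𝕜 (Set.range e) := by
    rw [hy]
    exact Submodule.sub_mem _ hx
      (Submodule.smul_mem _ _ (Submodule.subset_span ⟨n, rfl⟩))
  have hny : f n y = 0 := by simp [hy, hb]
  have hxy : x = y + c • e n := by rw [hy, hc]; abel
  obtain ⟨B, hB, hPB⟩ := aux_support e f hb y hys
  have hnB : n ∉ B := fun h => (hB n).1 h hny
  obtain ⟨δ, hδ, hδB⟩ : ∃ δ > 0, ∀ k ∈ B, δ ≤ ‖f k y‖ := by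
    rcases B.eq_empty_or_nonempty with h | h
    · exact ⟨1, one_pos, by simp [h]⟩
    · obtain ⟨k, hk, hmin⟩ := B.exists_min_image (fun k => ‖f k y‖) h
      exact ⟨‖f k y‖, norm_pos_iff.2 ((hB k).1 hk), hmin⟩
  obtain ⟨t, ht0, ht1, htc⟩ : ∃ t : ℝ, 0 < t ∧ t ≤ 1 ∧ t * ‖c‖ ≤ δ := by
    have hp : 0 < δ + ‖c‖ := by positivity
    refine ⟨δ / (δ + ‖c‖), by positivity, ?_, ?_⟩
    · rw [div_le_one hp]; linarith [norm_nonneg c]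
    · rw [div_mul_eq_mul_div, div_le_iff₀ hp]; nlinarith [norm_nonneg c]
  have hfz : ∀ k, f k (y + ((t : 𝕜) * c) • e n) =
      f k y + if k = n then (t : 𝕜) * c else 0 := by
    intro k; simp [hb]
  have hP : greedyProj e f B (y + ((t : 𝕜) * c) • e n) = y := by
    conv_rhs => rw [← hPB]
    refine Finset.sum_congr rfl fun k hk => ?_
    rw [hfz, if_neg (ne_of_mem_of_not_mem hk hnB), add_zero]
  have hnorm : ‖(t : 𝕜) * c‖ = t * ‖c‖ := by
    rw [norm_mul, RCLike.norm_ofReal, abs_of_pos ht0]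
  have hg : IsGreedySet f (y + ((t : 𝕜) * c) • e n) B := by
    intro k hk j hj
    have hj0 : f j y = 0 := by
      by_contra h
      exact hj ((hB j).2 h)
    rw [hfz, hfz, if_neg (ne_of_mem_of_not_mem hk hnB), add_zero, hj0, zero_add]
    refine le_trans ?_ (hδB k hk)
    split_ifs
    · rw [hnorm]; exact htc
    · rw [norm_zero]; exact hδ.le
  have h1 := H _ B hg
  rw [hP] at h1
  have h2 : y + ((t : 𝕜) * c) • e n = ((1 - t : ℝ) : 𝕜) • y + (t : 𝕜) • x := by
    rw [hxy]; push_cast; module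
  have h3 : ‖y + ((t : 𝕜) * c) • e n‖ ≤ (1 - t) * ‖y‖ + t * ‖x‖ := by
    rw [h2]
    refine (norm_add_le _ _).trans (le_of_eq ?_)
    rw [norm_smul, norm_smul, RCLike.norm_ofReal, RCLike.norm_ofReal, abs_of_pos ht0,
      abs_of_nonneg (by linarith)]
  rw [← hy]
  have h4 : t * ‖y‖ ≤ t * ‖x‖ := by linarith
  exact le_of_mul_le_mul_left h4 ht0

theorem aux_supp (e : ℕ → X) (f : ℕ → X →L[𝕜] 𝕜) (hsys : BiorthSystem 𝕜 e f)
    (H : ∀ (x : X) (A : Finset ℕ), IsGreedySet f x A → ‖greedyProj e f A x‖ ≤ ‖x‖)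
    (x : X) (A : Finset ℕ) : ‖x - greedyProj e f A x‖ ≤ ‖x‖ := by
  classical
  induction A using Finset.induction_on with
  | empty => simp [greedyProj]
  | insert n A hn ih =>
    refine le_trans ?_ ih
    have h := aux_single_s14 e f hsys H n (x - greedyProj e f A x)
    have h0 : f n (greedyProj e f A x) = 0 := by simp [greedyProj, hsys.1, hn]
    rw [map_sub, h0, sub_zero] at h
    have h5 : x - greedyProj e f (insert n A) x = x - greedyProj e f A x - f n x • e n := by
      unfold greedyProj
      rw [Finset.sum_insert hn]
      abel
    rw [h5]
    exact h

/-- Characterization of `1`-quasi-greedy systems: quasi-greedy with constant `1` in the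
two-sided sense, in the one-sided sense, and `1`-suppression unconditional, are equivalent. -/
theorem stmt_14 (hX : ¬ FiniteDimensional 𝕜 X) (e : ℕ → X) (f : ℕ → X →L[𝕜] 𝕜)
    (hsys : BiorthSystem 𝕜 e f) :
    ((∀ (x : X) (A : Finset ℕ), IsGreedySet f x A →
        ‖greedyProj e f A x‖ ≤ ‖x‖ ∧ ‖x - greedyProj e f A x‖ ≤ ‖x‖) ↔
      (∀ (x : X) (A : Finset ℕ), IsGreedySet f x A → ‖greedyProj e f A x‖ ≤ ‖x‖)) ∧
    ((∀ (x : X) (A : Finset ℕ), IsGreedySet f x A → ‖greedyProj e f A x‖ ≤ ‖x‖) ↔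
      (∀ (x : X) (A : Finset ℕ), ‖x - greedyProj e f A x‖ ≤ ‖x‖)) := by
  have h23 := aux_supp e f hsys
  have h32 := aux_proj e f hsys
  refine ⟨⟨fun h x A hA => (h x A hA).1, fun h x A hA => ⟨h x A hA, h23 h x A⟩⟩,
    ⟨fun h => h23 h, fun h x A _ => h32 h A x⟩⟩
end
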